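/- Weak-type off-diagonal extrapolation: Let 1 ≤ p₀ ≤ q₀ < ∞ and γ > 0, and let T be an operator mapping measurable functions on ℝⁿ to measurable functions on ℝⁿ (not assumed linear). Suppose there is a constant c₀ such that for every weight w ∈ A_{p₀,q₀} and every measurable f, ‖Tf‖_{L^{q₀,∞}(w^{q₀})} ≤ c₀ [w]_{A_{p₀,q₀}}^γ ‖w·f‖_{L^{p₀}(ℝⁿ)}. Then for every pair p, q with 1 < p ≤ q < ∞ and 1/p − 1/q = 1/p₀ − 1/q₀ there is a constant c (depending only on n, p₀, q₀, p, q, γ, c₀) such that for every w ∈ A_{p,q} and every measurable f, ‖Tf‖_{L^{q,∞}(w^{q})} ≤ c [w]_{A_{p,q}}^{γ·max{1, (q₀/p₀′)·(p′/q)}} ‖w·f‖_{L^{p}(ℝⁿ)}. -/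

import Mathlib

open MeasureTheory ENNReal Set

noncomputable section

/-- Euclidean space `ℝⁿ`. -/
abbrev Euc (n : ℕ) := EuclideanSpace ℝ (Fin n)

variable {n : ℕ}

/-- The axis-parallel closed cube with lower corner `a` and side length `h`. -/
def Cube (a : Euc n) (h : ℝ) : Set (Euc n) :=
  {x | ∀ i, a i ≤ x i ∧ x i ≤ a i + h}

/-- The weighted measure `u(E) = ∫_E u dx` of a set. -/
def wMeas (u : Euc n → ℝ) (E : Set (Euc n)) : ℝ≥0∞ :=
  ∫⁻ x in E, ENNReal.ofReal (u x)

/-- The dual exponent `p' = p/(p-1)`. -/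
def dualExp (p : ℝ) : ℝ := p / (p - 1)

/-- The `A_{p,q}` constant of a weight `w` (with the `A_{1,q}` convention when `p = 1`). -/
def Apq (p q : ℝ) (w : Euc n → ℝ) : ℝ≥0∞ :=
  ⨆ (a : Euc n) (h : ℝ) (_ : 0 < h),
    ((volume (Cube a h))⁻¹ * ∫⁻ x in Cube a h, ENNReal.ofReal (w x) ^ q) *
      (if p = 1 then
        (essSup (fun x => (ENNReal.ofReal (w x))⁻¹) (volume.restrict (Cube a h))) ^ q
      else
        ((volume (Cube a h))⁻¹ * ∫⁻ x in Cube a h,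
            ENNReal.ofReal (w x) ^ (-(dualExp p))) ^ (q / dualExp p))

/-- The weighted Lebesgue norm `‖w f‖_{L^p(ℝⁿ)}`. -/
def wLp (w f : Euc n → ℝ) (p : ℝ) : ℝ≥0∞ :=
  (∫⁻ x, (ENNReal.ofReal (w x) * ENNReal.ofReal |f x|) ^ p) ^ (1 / p)

/-- The weighted Lebesgue norm `‖w g‖_{L^q(ℝⁿ)}` of an `ℝ≥0∞`-valued function. -/
def wLpE (w : Euc n → ℝ) (g : Euc n → ℝ≥0∞) (q : ℝ) : ℝ≥0∞ :=
  (∫⁻ x, (ENNReal.ofReal (w x) * g x) ^ q) ^ (1 / q)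

/-- The weak norm `‖g‖_{L^{q,∞}(u)} = sup_{λ>0} λ u({|g|>λ})^{1/q}`. -/
def weakLp (u : Euc n → ℝ) (g : Euc n → ℝ) (q : ℝ) : ℝ≥0∞ :=
  ⨆ (t : ℝ) (_ : 0 < t), ENNReal.ofReal t * wMeas u {x | t < |g x|} ^ (1 / q)

/-- The weak norm of an `ℝ≥0∞`-valued function. -/
def weakLpE (u : Euc n → ℝ) (g : Euc n → ℝ≥0∞) (q : ℝ) : ℝ≥0∞ :=
  ⨆ (t : ℝ) (_ : 0 < t), ENNReal.ofReal t * wMeas u {x | ENNReal.ofReal t < g x} ^ (1 / q)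

/-- The fractional integral (Riesz potential) `I_α f(x) = ∫ |f(y)| |x-y|^{α-n} dy`. -/
def riesz (α : ℝ) (f : Euc n → ℝ) (x : Euc n) : ℝ≥0∞ :=
  ∫⁻ y, ENNReal.ofReal |f y| * ENNReal.ofReal (‖x - y‖ ^ (α - (n : ℝ)))

/-- The fractional maximal operator `M_α f(x) = sup_{Q ∋ x} |Q|^{α/n-1} ∫_Q |f|`. -/
def fracMax (α : ℝ) (f : Euc n → ℝ) (x : Euc n) : ℝ≥0∞ :=
  ⨆ (a : Euc n) (h : ℝ) (_ : 0 < h) (_ : x ∈ Cube a h),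
    volume (Cube a h) ^ (α / (n : ℝ) - 1) * ∫⁻ y in Cube a h, ENNReal.ofReal |f y|


/-! ### Geometry of centred cubes -/

/-- Closed cube centred at `x` with half side `t`. -/
def Qc (x : Euc n) (t : ℝ) : Set (Euc n) := {y | ∀ i, |y i - x i| ≤ t}

lemma Qc_eq_preimage (x : Euc n) {t : ℝ} (ht : 0 ≤ t) :
    Qc x t = (fun y : Euc n => (fun i => y i : Fin n → ℝ)) ⁻¹'
      Metric.closedBall (fun i => x i : Fin n → ℝ) t := by
  ext y
  simp only [Qc, mem_setOf_eq, mem_preimage, Metric.mem_closedBall]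
  rw [dist_pi_le_iff ht]
  simp [Real.dist_eq]

lemma isClosed_Qc (x : Euc n) (t : ℝ) : IsClosed (Qc x t) := by
  have : Qc x t = ⋂ i, {y : Euc n | |y i - x i| ≤ t} := by ext y; simp [Qc]
  rw [this]
  refine isClosed_iInter fun i => isClosed_le ?_ continuous_const
  fun_prop

lemma measurableSet_Qc (x : Euc n) (t : ℝ) : MeasurableSet (Qc x t) :=
  (isClosed_Qc x t).measurableSet

lemma isClosed_Cube (a : Euc n) (h : ℝ) : IsClosed (Cube a h) := by
  have : Cube a h = ⋂ i, {y : Euc n | a i ≤ y i ∧ y i ≤ a i + h} := by ext y; simp [Cube]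
  rw [this]
  refine isClosed_iInter fun i => ?_
  refine IsClosed.and ?_ ?_
  · exact isClosed_le continuous_const (by fun_prop)
  · exact isClosed_le (by fun_prop) continuous_const

lemma measurableSet_Cube (a : Euc n) (h : ℝ) : MeasurableSet (Cube a h) :=
  (isClosed_Cube a h).measurableSet

lemma volume_Cube (a : Euc n) (h : ℝ) : volume (Cube a h) = ENNReal.ofReal h ^ n := by
  have hm := EuclideanSpace.volume_preserving_symm_measurableEquiv_toLp (Fin n)
  have : Cube a h = (MeasurableEquiv.toLp 2 (Fin n → ℝ)).symm ⁻¹'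
      (Icc (fun i => a i) (fun i => a i + h)) := by
    ext y
    simp only [Cube, mem_setOf_eq, mem_preimage, mem_Icc, Pi.le_def]
    exact forall_and
  rw [this, hm.measure_preimage measurableSet_Icc.nullMeasurableSet, Real.volume_Icc_pi]
  simp

lemma Qc_eq_Cube (x : Euc n) (t : ℝ) :
    Qc x t = Cube (WithLp.toLp 2 (fun i => x i - t)) (2 * t) := by
  ext y
  simp only [Qc, Cube, mem_setOf_eq, abs_le]
  refine forall_congr' fun i => ?_
  constructor <;> rintro ⟨h1, h2⟩ <;> constructor <;> linarith

lemma volume_Qc (x : Euc n) (t : ℝ) : volume (Qc x t) = ENNReal.ofReal (2 * t) ^ n := by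
  rw [Qc_eq_Cube, volume_Cube]

lemma volume_Cube_ne_zero (a : Euc n) {h : ℝ} (hh : 0 < h) : volume (Cube a h) ≠ 0 := by
  rw [volume_Cube]; exact pow_ne_zero _ (by simpa using hh)

lemma volume_Cube_ne_top (a : Euc n) (h : ℝ) : volume (Cube a h) ≠ ⊤ := by
  rw [volume_Cube]; exact ENNReal.pow_ne_top ENNReal.ofReal_ne_top

lemma volume_Qc_ne_zero (a : Euc n) {h : ℝ} (hh : 0 < h) : volume (Qc a h) ≠ 0 := by
  rw [Qc_eq_Cube]; exact volume_Cube_ne_zero _ (by linarith)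

lemma volume_Qc_ne_top (a : Euc n) (h : ℝ) : volume (Qc a h) ≠ ⊤ := by
  rw [Qc_eq_Cube]; exact volume_Cube_ne_top _ _

lemma iUnion_Qc : (⋃ j : ℕ, Qc (0 : Euc n) ((j : ℝ) + 1)) = univ := by
  refine eq_univ_of_forall fun x => ?_
  obtain ⟨j, hj⟩ := exists_nat_ge ‖x‖
  refine mem_iUnion.2 ⟨j, fun i => ?_⟩
  have := EuclideanSpace.norm_eq x
  have h2 : |x i| ≤ ‖x‖ := by
    simpa using PiLp.norm_apply_le x i
  simp
  linarith

/-- Besicovitch covering for centred cubes. -/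
lemma besicovitch_Qc (n : ℕ) : ∃ N : ℕ, ∀ (S : Set (Euc n)) (r : Euc n → ℝ) (R : ℝ),
    (∀ x ∈ S, 0 < r x) → (∀ x ∈ S, r x ≤ R) →
    ∃ s : Fin N → Set (Euc n), (∀ i, (s i) ⊆ S) ∧ (∀ i, (s i).Countable) ∧
      (∀ i, (s i).PairwiseDisjoint fun x => Qc x (r x)) ∧
      S ⊆ ⋃ i, ⋃ x ∈ s i, Qc x (r x) := by
  obtain ⟨N, τ, hτ, hN⟩ := HasBesicovitchCovering.no_satelliteConfig (α := Fin n → ℝ)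
  refine ⟨N, fun S r R h0 hR => ?_⟩
  let P : Besicovitch.BallPackage S (Fin n → ℝ) :=
    { c := fun x => fun i => (x : Euc n) i
      r := fun x => r x
      rpos := fun x => h0 x x.2
      r_bound := R
      r_le := fun x => hR x x.2 }
  obtain ⟨s, hs, hcov⟩ := Besicovitch.exist_disjoint_covering_families hτ hN P
  refine ⟨fun i => Set.image Subtype.val (s i), ?_, ?_, ?_, ?_⟩
  · rintro i _ ⟨x, _, rfl⟩; exact x.2
  · intro i
    refine Countable.image ?_ _
    refine (hs i).countable_of_nonempty_interior fun j _ => ?_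
    refine ⟨P.c j, ?_⟩
    rw [mem_interior_iff_mem_nhds]
    exact Metric.closedBall_mem_nhds _ (P.rpos j)
  · intro i
    rintro _ ⟨x, hx, rfl⟩ _ ⟨y, hy, rfl⟩ hxy
    have := hs i hx hy (fun h => hxy (congrArg _ h))
    simp only [Function.onFun] at this ⊢
    rw [Qc_eq_preimage _ (h0 x x.2).le, Qc_eq_preimage _ (h0 y y.2).le]
    exact this.preimage _
  · intro x hx
    have := hcov ⟨⟨x, hx⟩, rfl⟩
    simp only [mem_iUnion] at this ⊢
    obtain ⟨i, j, hj, hxj⟩ := this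
    refine ⟨i, j, ⟨j, hj, rfl⟩, ?_⟩
    rw [Qc_eq_preimage _ (h0 j j.2).le]
    exact Metric.ball_subset_closedBall hxj

/-- Centred maximal operator over cubes with dyadic half side, with respect to `μ`. -/
def MX (μ : Measure (Euc n)) (f : Euc n → ℝ≥0∞) (x : Euc n) : ℝ≥0∞ :=
  ⨆ k : ℤ, (∫⁻ y in Qc x ((2 : ℝ) ^ k), f y ∂μ) / μ (Qc x ((2 : ℝ) ^ k))

lemma two_zpow_pos (k : ℤ) : (0 : ℝ) < (2 : ℝ) ^ k := by positivity

lemma measurable_lintegral_Qc (μ : Measure (Euc n)) [SFinite μ] {f : Euc n → ℝ≥0∞}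
    (hf : Measurable f) (t : ℝ) : Measurable fun x => ∫⁻ y in Qc x t, f y ∂μ := by
  have h : ∀ x, ∫⁻ y in Qc x t, f y ∂μ =
      ∫⁻ y, ({z : Euc n × Euc n | ∀ i, |z.2 i - z.1 i| ≤ t}.indicator (fun z => f z.2)) (x, y) ∂μ := by
    intro x
    rw [← lintegral_indicator (measurableSet_Qc x t)]
    rfl
  simp_rw [h]
  refine Measurable.lintegral_prod_right' ?_
  refine (hf.comp measurable_snd).indicator ?_
  have : {z : Euc n × Euc n | ∀ i, |z.2 i - z.1 i| ≤ t} =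
      ⋂ i, {z : Euc n × Euc n | |z.2 i - z.1 i| ≤ t} := by ext; simp
  rw [this]
  refine MeasurableSet.iInter fun i => ?_
  refine (isClosed_le ?_ continuous_const).measurableSet
  fun_prop

lemma measurable_MX (μ : Measure (Euc n)) [SFinite μ] {f : Euc n → ℝ≥0∞}
    (hf : Measurable f) : Measurable (MX μ f) := by
  refine Measurable.iSup fun k => ?_
  refine (measurable_lintegral_Qc μ hf _).div ?_
  have := measurable_lintegral_Qc μ (f := fun _ => 1) measurable_const ((2 : ℝ) ^ k)
  simpa using this

/-- Weak type (1,1) with a dimensional constant for every measure. -/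
lemma weak_type (n : ℕ) : ∃ N : ℕ, ∀ (μ : Measure (Euc n)) (f : Euc n → ℝ≥0∞) (l : ℝ≥0∞),
    l * μ {x | l < MX μ f x} ≤ N * ∫⁻ x, f x ∂μ := by
  obtain ⟨N, hN⟩ := besicovitch_Qc n
  refine ⟨N, fun μ f l => ?_⟩
  let S : ℕ → Set (Euc n) := fun m =>
    {x | ∃ k : ℤ, k ≤ m ∧ l * μ (Qc x ((2 : ℝ) ^ k)) < ∫⁻ y in Qc x ((2 : ℝ) ^ k), f y ∂μ}
  have hS : {x | l < MX μ f x} ⊆ ⋃ m, S m := by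
    intro x hx
    simp only [mem_setOf_eq, MX, lt_iSup_iff] at hx
    obtain ⟨k, hk⟩ := hx
    exact mem_iUnion.2 ⟨k.toNat, k, Int.self_le_toNat k, ENNReal.mul_lt_of_lt_div hk⟩
  have hmono : Monotone S := by
    rintro a b hab x ⟨k, hk, h⟩
    exact ⟨k, hk.trans (by exact_mod_cast hab), h⟩
  have hSm : ∀ m, l * μ (S m) ≤ N * ∫⁻ x, f x ∂μ := by
    intro m
    classical
    let κ : Euc n → ℤ := fun x => if h : x ∈ S m then h.choose else 0
    have hκ : ∀ x ∈ S m, κ x ≤ m ∧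
        l * μ (Qc x ((2 : ℝ) ^ κ x)) < ∫⁻ y in Qc x ((2 : ℝ) ^ κ x), f y ∂μ := by
      intro x hx
      have : κ x = hx.choose := by simp only [κ, hx, dif_pos]
      rw [this]; exact hx.choose_spec
    obtain ⟨s, hsS, hsc, hsd, hcov⟩ := hN (S m) (fun x => (2 : ℝ) ^ κ x) ((2 : ℝ) ^ (m : ℤ))
      (fun x _ => two_zpow_pos _) (fun x hx => zpow_le_zpow_right₀ (by norm_num) (hκ x hx).1)
    calc l * μ (S m) ≤ l * ∑ i, ∑' x : s i, μ (Qc (x : Euc n) ((2 : ℝ) ^ κ x)) := by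
          gcongr
          refine (measure_mono hcov).trans ((measure_iUnion_fintype_le _ _).trans ?_)
          refine Finset.sum_le_sum fun i _ => ?_
          exact measure_biUnion_le _ (hsc i) _
      _ = ∑ i, ∑' x : s i, l * μ (Qc (x : Euc n) ((2 : ℝ) ^ κ x)) := by
          rw [Finset.mul_sum]; simp_rw [ENNReal.tsum_mul_left]
      _ ≤ ∑ i : Fin N, ∫⁻ x, f x ∂μ := by
          refine Finset.sum_le_sum fun i _ => ?_
          calc _ ≤ ∑' x : s i, ∫⁻ y in Qc (x : Euc n) ((2 : ℝ) ^ κ x), f y ∂μ :=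
                ENNReal.tsum_le_tsum fun x => (hκ x (hsS i x.2)).2.le
            _ = ∫⁻ y in ⋃ x ∈ s i, Qc (x : Euc n) ((2 : ℝ) ^ κ x), f y ∂μ :=
                (lintegral_biUnion (hsc i) (fun x _ => measurableSet_Qc _ _) (hsd i) _).symm
            _ ≤ _ := setLIntegral_le_lintegral _ _
      _ = N * ∫⁻ x, f x ∂μ := by simp
  calc l * μ {x | l < MX μ f x} ≤ l * μ (⋃ m, S m) := by gcongr
    _ = ⨆ m, l * μ (S m) := by rw [hmono.measure_iUnion, ENNReal.mul_iSup]
    _ ≤ _ := iSup_le hSm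


/-! ### Strong type -/

lemma two_zpow_lt_top (k : ℤ) : (2 : ℝ≥0∞) ^ k < ⊤ :=
  ENNReal.zpow_lt_top (by norm_num) (by norm_num) k

lemma two_zpow_ne_zero (k : ℤ) : (2 : ℝ≥0∞) ^ k ≠ 0 :=
  (ENNReal.zpow_pos (by norm_num) (by norm_num) k).ne'

lemma rpow_le_tsum_levels (a : ℝ≥0∞) {r : ℝ} (hr : 0 < r) :
    a ^ r ≤ ∑' k : ℤ, if (2 : ℝ≥0∞) ^ (k + 1) < a then ((2 : ℝ≥0∞) ^ (k + 2)) ^ r else 0 := by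
  rcases eq_or_ne a 0 with rfl | h0
  · simp [hr]
  rcases eq_or_ne a ⊤ with rfl | ht
  · have hinj : Function.Injective (fun j : ℕ => (j : ℤ)) := Nat.cast_injective
    refine le_trans ?_ (ENNReal.tsum_comp_le_tsum_of_injective hinj _)
    have : ∑' _ : ℕ, (1 : ℝ≥0∞) = ⊤ := ENNReal.tsum_const_eq_top_of_ne_zero one_ne_zero
    rw [ENNReal.top_rpow_of_pos hr]
    refine this.ge.trans ?_
    refine ENNReal.tsum_le_tsum fun j => ?_
    rw [if_pos (two_zpow_lt_top _)]
    refine ENNReal.one_le_rpow ?_ hr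
    have : ((j : ℤ) + 2) = ((j + 2 : ℕ) : ℤ) := by push_cast; ring
    rw [this, zpow_natCast]
    exact one_le_pow₀ (by norm_num)
  · obtain ⟨m, hm1, hm2⟩ := ENNReal.exists_mem_Ioc_zpow h0 ht (y := 2) (by norm_num) (by norm_num)
    refine le_trans ?_ (ENNReal.le_tsum (m - 1))
    rw [if_pos (by simpa using hm1)]
    refine ENNReal.rpow_le_rpow ?_ hr.le
    have : m - 1 + 2 = m + 1 := by ring
    rw [this]; exact hm2

lemma tsum_levels_le {s : ℝ} (hs : 0 < s) : ∃ C : ℝ≥0∞, C ≠ ⊤ ∧ ∀ a : ℝ≥0∞,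
    ∑' k : ℤ, (if (2 : ℝ≥0∞) ^ k < a then (2 : ℝ≥0∞) ^ ((k : ℝ) * s) else 0) ≤ C * a ^ s := by
  have hlt : (2 : ℝ≥0∞) ^ (-s) < 1 := ENNReal.rpow_lt_one_of_one_lt_of_neg (by norm_num) (by linarith)
  have hC0 : (1 - (2 : ℝ≥0∞) ^ (-s))⁻¹ ≠ 0 := by simp
  refine ⟨(1 - (2 : ℝ≥0∞) ^ (-s))⁻¹, ?_, fun a => ?_⟩
  · rw [ne_eq, ENNReal.inv_eq_top, tsub_eq_zero_iff_le, not_le]; exact hlt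
  rcases eq_or_ne a 0 with rfl | h0
  · simp
  rcases eq_or_ne a ⊤ with rfl | ht
  · rw [ENNReal.top_rpow_of_pos hs, ENNReal.mul_top hC0]; exact le_top
  obtain ⟨m, hm1, hm2⟩ := ENNReal.exists_mem_Ioc_zpow h0 ht (y := 2) (by norm_num) (by norm_num)
  have h1 : ∀ k : ℤ, (if (2 : ℝ≥0∞) ^ k < a then (2 : ℝ≥0∞) ^ ((k : ℝ) * s) else 0) ≤
      if k ≤ m then (2 : ℝ≥0∞) ^ ((k : ℝ) * s) else 0 := by
    intro k
    by_cases hk : k ≤ m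
    · simp only [hk, if_true]; split_ifs <;> simp
    · rw [if_neg]; · simp
      rw [not_lt]
      exact hm2.trans (ENNReal.zpow_le_of_le (by norm_num) (by omega))
  refine (ENNReal.tsum_le_tsum h1).trans ?_
  have hinj : Function.Injective (fun j : ℕ => m - (j : ℤ)) := by
    intro a b h; simpa using h
  rw [← hinj.tsum_eq]
  · have h2 : ∀ j : ℕ, (if m - (j : ℤ) ≤ m then (2 : ℝ≥0∞) ^ (((m - (j : ℤ) : ℤ) : ℝ) * s) else 0) =
        (2 : ℝ≥0∞) ^ ((m : ℝ) * s) * ((2 : ℝ≥0∞) ^ (-s)) ^ j := by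
      intro j
      rw [if_pos (by omega), ← ENNReal.rpow_natCast, ← ENNReal.rpow_mul,
        ← ENNReal.rpow_add _ _ (by norm_num) (by norm_num)]
      congr 1
      push_cast; ring
    simp_rw [h2]
    rw [ENNReal.tsum_mul_left, ENNReal.tsum_geometric, mul_comm]
    gcongr
    rw [ENNReal.rpow_mul, ENNReal.rpow_intCast]
    exact ENNReal.rpow_le_rpow hm1.le hs.le
  · intro k hk
    by_cases h : k ≤ m
    · exact ⟨(m - k).toNat, by simp; omega⟩
    · simp [h] at hk

lemma MX_le_add (μ : Measure (Euc n)) {f g : Euc n → ℝ≥0∞} (l : ℝ≥0∞)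
    (hfg : ∀ x, f x ≤ g x + l) (x : Euc n) : MX μ f x ≤ MX μ g x + l := by
  refine iSup_le fun k => ?_
  calc (∫⁻ y in Qc x ((2 : ℝ) ^ k), f y ∂μ) / μ (Qc x ((2 : ℝ) ^ k))
      ≤ (∫⁻ y in Qc x ((2 : ℝ) ^ k), (g y + l) ∂μ) / μ (Qc x ((2 : ℝ) ^ k)) := by
        gcongr with y; exact hfg y
    _ = (∫⁻ y in Qc x ((2 : ℝ) ^ k), g y ∂μ) / μ (Qc x ((2 : ℝ) ^ k)) +
        l * (μ (Qc x ((2 : ℝ) ^ k)) / μ (Qc x ((2 : ℝ) ^ k))) := by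
        rw [lintegral_add_right _ measurable_const, ENNReal.add_div]
        simp [mul_div_assoc]
    _ ≤ MX μ g x + l * 1 := by
        gcongr
        · exact le_iSup (fun k : ℤ => (∫⁻ y in Qc x ((2 : ℝ) ^ k), g y ∂μ) / μ (Qc x ((2 : ℝ) ^ k))) k
        · exact ENNReal.div_self_le_one
    _ = _ := by rw [mul_one]

lemma strong_type (n : ℕ) {r : ℝ} (hr : 1 < r) : ∃ C : ℝ≥0∞, C ≠ ⊤ ∧
    ∀ (μ : Measure (Euc n)) [SFinite μ] (f : Euc n → ℝ≥0∞), Measurable f →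
      ∫⁻ x, MX μ f x ^ r ∂μ ≤ C * ∫⁻ x, f x ^ r ∂μ := by
  obtain ⟨N, hN⟩ := weak_type n
  obtain ⟨C, hC, hCa⟩ := tsum_levels_le (s := r - 1) (by linarith)
  have h4 : ((2 : ℝ≥0∞) ^ (2 * r)) ≠ ⊤ :=
    ENNReal.rpow_ne_top_of_nonneg (by linarith) (by norm_num)
  refine ⟨N * (2 : ℝ≥0∞) ^ (2 * r) * C, by finiteness, fun μ _ f hf => ?_⟩
  have hMm := measurable_MX μ hf
  -- truncation
  have hlev : ∀ k : ℤ, ((2 : ℝ≥0∞) ^ (k + 2)) ^ r * μ {x | (2 : ℝ≥0∞) ^ (k + 1) < MX μ f x} ≤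
      N * (2 : ℝ≥0∞) ^ (2 * r) *
        ∫⁻ x, f x * (if (2 : ℝ≥0∞) ^ k < f x then (2 : ℝ≥0∞) ^ ((k : ℝ) * (r - 1)) else 0) ∂μ := by
    intro k
    set g : Euc n → ℝ≥0∞ := {x | (2 : ℝ≥0∞) ^ k < f x}.indicator f with hg
    have hfg : ∀ x, f x ≤ g x + (2 : ℝ≥0∞) ^ k := by
      intro x
      by_cases hx : (2 : ℝ≥0∞) ^ k < f x
      · rw [hg, indicator_of_mem (by exact hx)]; exact le_self_add
      · exact (not_lt.1 hx).trans le_add_self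
    have hsub : {x | (2 : ℝ≥0∞) ^ (k + 1) < MX μ f x} ⊆ {x | (2 : ℝ≥0∞) ^ k < MX μ g x} := by
      intro x hx
      by_contra hcon
      have hcon' : MX μ g x ≤ (2 : ℝ≥0∞) ^ k := not_lt.1 hcon
      have hx' : (2 : ℝ≥0∞) ^ (k + 1) < MX μ f x := hx
      have := hx'.trans_le (MX_le_add μ _ hfg x)
      have h2 : (2 : ℝ≥0∞) ^ (k + 1) = (2 : ℝ≥0∞) ^ k + (2 : ℝ≥0∞) ^ k := by
        rw [ENNReal.zpow_add (by norm_num) (by norm_num), zpow_one, mul_two]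
      rw [h2] at this
      exact absurd (this.trans_le (add_le_add_left hcon' _)) (lt_irrefl _)
    have hpow : ((2 : ℝ≥0∞) ^ (k + 2)) ^ r =
        (2 : ℝ≥0∞) ^ (2 * r) * (2 : ℝ≥0∞) ^ ((k : ℝ) * (r - 1)) * (2 : ℝ≥0∞) ^ k := by
      rw [← ENNReal.rpow_intCast, ← ENNReal.rpow_intCast, ← ENNReal.rpow_mul,
        ← ENNReal.rpow_add _ _ (by norm_num) (by norm_num),
        ← ENNReal.rpow_add _ _ (by norm_num) (by norm_num)]
      congr 1
      push_cast; ring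
    calc ((2 : ℝ≥0∞) ^ (k + 2)) ^ r * μ {x | (2 : ℝ≥0∞) ^ (k + 1) < MX μ f x}
        ≤ ((2 : ℝ≥0∞) ^ (k + 2)) ^ r * μ {x | (2 : ℝ≥0∞) ^ k < MX μ g x} := by gcongr
      _ = (2 : ℝ≥0∞) ^ (2 * r) * (2 : ℝ≥0∞) ^ ((k : ℝ) * (r - 1)) *
          ((2 : ℝ≥0∞) ^ k * μ {x | (2 : ℝ≥0∞) ^ k < MX μ g x}) := by rw [hpow, mul_assoc]
      _ ≤ (2 : ℝ≥0∞) ^ (2 * r) * (2 : ℝ≥0∞) ^ ((k : ℝ) * (r - 1)) * (N * ∫⁻ x, g x ∂μ) := by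
          exact mul_le_mul_right (hN μ g _) _
      _ = N * (2 : ℝ≥0∞) ^ (2 * r) * ((2 : ℝ≥0∞) ^ ((k : ℝ) * (r - 1)) * ∫⁻ x, g x ∂μ) := by ring
      _ = _ := by
          congr 1
          rw [← lintegral_const_mul]
          · refine lintegral_congr fun x => ?_
            by_cases hx : (2 : ℝ≥0∞) ^ k < f x
            · rw [hg, indicator_of_mem (by exact hx), if_pos hx, mul_comm]
            · rw [hg, indicator_of_notMem (by exact hx), if_neg hx]; simp
          · exact hf.indicator (measurableSet_lt measurable_const hf)
  calc ∫⁻ x, MX μ f x ^ r ∂μ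
      ≤ ∫⁻ x, ∑' k : ℤ, (if (2 : ℝ≥0∞) ^ (k + 1) < MX μ f x then
          ((2 : ℝ≥0∞) ^ (k + 2)) ^ r else 0) ∂μ :=
        lintegral_mono fun x => rpow_le_tsum_levels _ (by linarith)
    _ = ∑' k : ℤ, ((2 : ℝ≥0∞) ^ (k + 2)) ^ r * μ {x | (2 : ℝ≥0∞) ^ (k + 1) < MX μ f x} := by
        rw [lintegral_tsum]
        · refine tsum_congr fun k => ?_
          have hms : MeasurableSet {x | (2 : ℝ≥0∞) ^ (k + 1) < MX μ f x} :=
            measurableSet_lt measurable_const hMm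
          rw [← lintegral_indicator_const hms]
          refine lintegral_congr fun x => ?_
          by_cases hx : (2 : ℝ≥0∞) ^ (k + 1) < MX μ f x
          · rw [indicator_of_mem (by exact hx), if_pos hx]
          · rw [indicator_of_notMem (by exact hx), if_neg hx]
        · intro k
          exact (Measurable.ite (measurableSet_lt measurable_const hMm) measurable_const
            measurable_const).aemeasurable
    _ ≤ ∑' k : ℤ, N * (2 : ℝ≥0∞) ^ (2 * r) *
        ∫⁻ x, f x * (if (2 : ℝ≥0∞) ^ k < f x then (2 : ℝ≥0∞) ^ ((k : ℝ) * (r - 1)) else 0) ∂μ :=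
        ENNReal.tsum_le_tsum hlev
    _ = N * (2 : ℝ≥0∞) ^ (2 * r) * ∫⁻ x, f x * ∑' k : ℤ,
          (if (2 : ℝ≥0∞) ^ k < f x then (2 : ℝ≥0∞) ^ ((k : ℝ) * (r - 1)) else 0) ∂μ := by
        rw [ENNReal.tsum_mul_left, ← lintegral_tsum]
        · simp_rw [ENNReal.tsum_mul_left]
        · intro k
          exact (hf.mul (Measurable.ite (measurableSet_lt measurable_const hf) measurable_const
            measurable_const)).aemeasurable
    _ ≤ N * (2 : ℝ≥0∞) ^ (2 * r) * ∫⁻ x, C * f x ^ r ∂μ := by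
        refine mul_le_mul_right (lintegral_mono fun x => ?_) _
        calc _ ≤ f x * (C * f x ^ (r - 1)) := mul_le_mul_right (hCa _) _
          _ = C * (f x ^ (1 : ℝ) * f x ^ (r - 1)) := by rw [ENNReal.rpow_one]; ring
          _ = C * f x ^ r := by
            rw [← ENNReal.rpow_add_of_nonneg _ _ zero_le_one (by linarith)]; congr 2; ring
    _ = _ := by rw [lintegral_const_mul _ (hf.pow_const r)]; ring


/-! ### Muckenhoupt weights and Buckley's bound (after Lerner) -/

/-- `W` is a nondegenerate weight whose `A_r` characteristic is at most `A < ∞`. -/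
structure ArW (r : ℝ) (W : Euc n → ℝ≥0∞) (A : ℝ≥0∞) : Prop where
  meas : Measurable W
  pos : ∀ᵐ x, W x ≠ 0
  fin : ∀ᵐ x, W x ≠ ⊤
  bound : ∀ (a : Euc n) (h : ℝ), 0 < h →
    (∫⁻ x in Cube a h, W x) * (∫⁻ x in Cube a h, W x ^ (-(1 / (r - 1)))) ^ (r - 1) ≤
      A * volume (Cube a h) ^ r
  ne_top : A ≠ ⊤

lemma setLIntegral_Cube_ne_zero {g : Euc n → ℝ≥0∞} (hg : Measurable g) (hpos : ∀ᵐ x, g x ≠ 0)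
    (a : Euc n) {h : ℝ} (hh : 0 < h) : ∫⁻ x in Cube a h, g x ≠ 0 := by
  intro h0
  rw [lintegral_eq_zero_iff hg] at h0
  have h1 : ∀ᵐ x ∂(volume.restrict (Cube a h)), g x ≠ 0 := ae_restrict_of_ae hpos
  have h2 : ∀ᵐ x ∂(volume.restrict (Cube a h)), False := by
    filter_upwards [h0, h1] with x hx1 hx2 using hx2 hx1
  rw [ae_iff] at h2
  simp at h2
  exact volume_Cube_ne_zero a hh h2

lemma rpow_ne_zero_of {a : ℝ≥0∞} {s : ℝ} (h0 : a ≠ 0) (ht : a ≠ ⊤) : a ^ s ≠ 0 :=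
  (ENNReal.rpow_pos (pos_iff_ne_zero.2 h0) ht).ne'

lemma rpow_ne_top_of {a : ℝ≥0∞} {s : ℝ} (h0 : a ≠ 0) (ht : a ≠ ⊤) : a ^ s ≠ ⊤ :=
  ENNReal.rpow_ne_top_of_ne_zero h0 ht

namespace ArW

variable {r : ℝ} {W : Euc n → ℝ≥0∞} {A : ℝ≥0∞}

lemma meas_dual (H : ArW r W A) : Measurable fun x => W x ^ (-(1 / (r - 1))) :=
  H.meas.pow_const _

lemma W_ne_zero (H : ArW r W A) (a : Euc n) {h : ℝ} (hh : 0 < h) :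
    ∫⁻ x in Cube a h, W x ≠ 0 := setLIntegral_Cube_ne_zero H.meas H.pos a hh

lemma pos_dual (H : ArW r W A) : ∀ᵐ x, W x ^ (-(1 / (r - 1))) ≠ 0 := by
  filter_upwards [H.pos, H.fin] with x h1 h2 using rpow_ne_zero_of h1 h2

lemma fin_dual (H : ArW r W A) : ∀ᵐ x, W x ^ (-(1 / (r - 1))) ≠ ⊤ := by
  filter_upwards [H.pos, H.fin] with x h1 h2 using rpow_ne_top_of h1 h2

lemma S_ne_zero (H : ArW r W A) (a : Euc n) {h : ℝ} (hh : 0 < h) :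
    ∫⁻ x in Cube a h, W x ^ (-(1 / (r - 1))) ≠ 0 :=
  setLIntegral_Cube_ne_zero H.meas_dual H.pos_dual a hh

lemma prod_ne_top (H : ArW r W A) (hr : 1 < r) (a : Euc n) {h : ℝ} (hh : 0 < h) :
    (∫⁻ x in Cube a h, W x) * (∫⁻ x in Cube a h, W x ^ (-(1 / (r - 1)))) ^ (r - 1) ≠ ⊤ := by
  refine ne_top_of_le_ne_top ?_ (H.bound a h hh)
  exact ENNReal.mul_ne_top H.ne_top
    (ENNReal.rpow_ne_top_of_nonneg (by linarith) (volume_Cube_ne_top a h))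

lemma S_ne_top (H : ArW r W A) (hr : 1 < r) (a : Euc n) {h : ℝ} (hh : 0 < h) :
    ∫⁻ x in Cube a h, W x ^ (-(1 / (r - 1))) ≠ ⊤ := by
  intro ht
  refine H.prod_ne_top hr a hh ?_
  rw [ht, ENNReal.top_rpow_of_pos (by linarith), ENNReal.mul_top (H.W_ne_zero a hh)]

lemma W_ne_top (H : ArW r W A) (hr : 1 < r) (a : Euc n) {h : ℝ} (hh : 0 < h) :
    ∫⁻ x in Cube a h, W x ≠ ⊤ := by
  intro ht
  refine H.prod_ne_top hr a hh ?_
  rw [ht, ENNReal.top_mul]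
  exact rpow_ne_zero_of (H.S_ne_zero a hh) (H.S_ne_top hr a hh)

lemma A_ne_zero (H : ArW r W A) (hr : 1 < r) : A ≠ 0 := by
  intro h0
  have := H.bound 0 1 one_pos
  rw [h0, zero_mul, nonpos_iff_eq_zero, mul_eq_zero] at this
  rcases this with h | h
  · exact H.W_ne_zero 0 one_pos h
  · exact rpow_ne_zero_of (H.S_ne_zero 0 one_pos) (H.S_ne_top hr 0 one_pos) h

lemma dual (H : ArW r W A) (hr : 1 < r) :
    ArW (r / (r - 1)) (fun x => W x ^ (-(1 / (r - 1)))) (A ^ (1 / (r - 1))) := by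
  have hr1 : r - 1 ≠ 0 := by linarith
  have hr0 : 0 < 1 / (r - 1) := by apply one_div_pos.2; linarith
  have e1 : r / (r - 1) - 1 = 1 / (r - 1) := by field_simp; ring
  refine ⟨H.meas_dual, H.pos_dual, H.fin_dual, fun a h hh => ?_,
    ENNReal.rpow_ne_top_of_nonneg hr0.le H.ne_top⟩
  have e2 : ∀ x, (W x ^ (-(1 / (r - 1)))) ^ (-(1 / (r / (r - 1) - 1))) = W x := by
    intro x
    rw [e1, ← ENNReal.rpow_mul]
    have : -(1 / (r - 1)) * -(1 / (1 / (r - 1))) = 1 := by field_simp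
    rw [this, ENNReal.rpow_one]
  simp_rw [e2]
  rw [e1]
  have := ENNReal.rpow_le_rpow (H.bound a h hh) hr0.le
  rw [ENNReal.mul_rpow_of_nonneg _ _ hr0.le, ENNReal.mul_rpow_of_nonneg _ _ hr0.le,
    ← ENNReal.rpow_mul, ← ENNReal.rpow_mul] at this
  have e3 : (r - 1) * (1 / (r - 1)) = 1 := by field_simp
  have e4 : r * (1 / (r - 1)) = r / (r - 1) := by field_simp
  rw [e3, e4, ENNReal.rpow_one, mul_comm] at this
  exact this

end ArW

lemma le_rpow_one_div {a b : ℝ≥0∞} {s : ℝ} (hs : 0 < s) : a ≤ b ^ (1 / s) ↔ a ^ s ≤ b := by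
  rw [one_div, ENNReal.le_rpow_inv_iff hs]

lemma le_MX (μ : Measure (Euc n)) (f : Euc n → ℝ≥0∞) (x : Euc n) (k : ℤ) :
    (∫⁻ y in Qc x ((2 : ℝ) ^ k), f y ∂μ) / μ (Qc x ((2 : ℝ) ^ k)) ≤ MX μ f x :=
  le_iSup (fun k : ℤ => (∫⁻ y in Qc x ((2 : ℝ) ^ k), f y ∂μ) / μ (Qc x ((2 : ℝ) ^ k))) k

/-- Buckley's sharp bound for the maximal function. -/
lemma buckley (n : ℕ) {r : ℝ} (hr : 1 < r) : ∃ C : ℝ≥0∞, C ≠ ⊤ ∧ ∀ (W : Euc n → ℝ≥0∞) (A : ℝ≥0∞),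
    ArW r W A → ∀ f : Euc n → ℝ≥0∞, Measurable f →
      ∫⁻ x, W x * MX volume f x ^ r ≤ C * A ^ (r / (r - 1)) * ∫⁻ x, W x * f x ^ r := by
  have hr1 : 0 < r - 1 := by linarith
  have hr' : 1 < r / (r - 1) := by rw [one_lt_div hr1]; linarith
  have hr'0 : 0 ≤ r / (r - 1) := by linarith
  obtain ⟨C1, hC1, H1⟩ := strong_type n hr'
  obtain ⟨C2, hC2, H2⟩ := strong_type n hr
  set c3 : ℝ≥0∞ := ((3 : ℝ≥0∞) ^ n) ^ r with hc3
  have hc3t : c3 ≠ ⊤ := ENNReal.rpow_ne_top_of_nonneg (by linarith) (by finiteness)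
  refine ⟨c3 ^ (r / (r - 1)) * C1 * C2, ?_, fun W A H f hf => ?_⟩
  · have : c3 ^ (r / (r - 1)) ≠ ⊤ := ENNReal.rpow_ne_top_of_nonneg hr'0 hc3t
    finiteness
  set S : Euc n → ℝ≥0∞ := fun x => W x ^ (-(1 / (r - 1))) with hS
  have hSm : Measurable S := H.meas_dual
  set μ : Measure (Euc n) := volume.withDensity W with hμ
  set ν : Measure (Euc n) := volume.withDensity S with hν
  set G : Euc n → ℝ≥0∞ := MX ν (fun x => f x / S x) with hG
  have hfS : Measurable fun x => f x / S x := hf.div hSm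
  have hGm : Measurable G := measurable_MX ν hfS
  set h : Euc n → ℝ≥0∞ := fun x => G x ^ (r - 1) / W x with hh
  have hhm : Measurable h := (hGm.pow_const _).div H.meas
  have step1 : ∀ x (k : ℤ), ∀ y ∈ Qc x ((2 : ℝ) ^ k),
      (∫⁻ z in Qc x ((2 : ℝ) ^ k), f z) / ν (Qc x (3 * (2 : ℝ) ^ k)) ≤ G y := by
    intro x k y hy
    have s1 : Qc x ((2 : ℝ) ^ k) ⊆ Qc y ((2 : ℝ) ^ (k + 1)) := by
      intro z hz i
      have h1 := hz i
      have h2 := hy i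
      rw [zpow_add₀ (by norm_num), zpow_one]
      rw [abs_le] at *
      constructor <;> linarith
    have s2 : Qc y ((2 : ℝ) ^ (k + 1)) ⊆ Qc x (3 * (2 : ℝ) ^ k) := by
      intro z hz i
      have h1 := hz i
      have h2 := hy i
      rw [zpow_add₀ (by norm_num), zpow_one] at h1
      rw [abs_le] at *
      constructor <;> linarith
    refine le_trans ?_ (le_MX ν _ y (k + 1))
    refine ENNReal.div_le_div ?_ (measure_mono s2)
    rw [hν, setLIntegral_withDensity_eq_setLIntegral_mul _ hSm hfS (measurableSet_Qc _ _)]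
    refine (lintegral_mono_set s1).trans (lintegral_mono_ae (ae_restrict_of_ae ?_))
    filter_upwards [H.pos_dual, H.fin_dual] with z h1 h2
    simp only [Pi.mul_apply]
    rw [ENNReal.mul_div_cancel h1 h2]
  have step2 : ∀ x, MX volume f x ^ (r - 1) ≤ c3 * A * MX μ h x := by
    intro x
    have : MX volume f x ≤ (c3 * A * MX μ h x) ^ (1 / (r - 1)) := by
      refine iSup_le fun k => ?_
      set Q := Qc x ((2 : ℝ) ^ k) with hQ
      set Q3 := Qc x (3 * (2 : ℝ) ^ k) with hQ3
      have hk : (0 : ℝ) < 2 ^ k := two_zpow_pos k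
      have hν3 : ν Q3 = ∫⁻ y in Q3, S y := withDensity_apply _ (measurableSet_Qc _ _)
      have hμQ : μ Q = ∫⁻ y in Q, W y := withDensity_apply _ (measurableSet_Qc _ _)
      have hν0 : ν Q3 ≠ 0 := by
        rw [hν3, hQ3, Qc_eq_Cube]; exact H.S_ne_zero _ (by linarith)
      have hνt : ν Q3 ≠ ⊤ := by
        rw [hν3, hQ3, Qc_eq_Cube]; exact H.S_ne_top hr _ (by linarith)
      have hμ0 : μ Q ≠ 0 := by
        rw [hμQ, hQ, Qc_eq_Cube]; exact H.W_ne_zero _ (by linarith)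
      have hμt : μ Q ≠ ⊤ := by
        rw [hμQ, hQ, Qc_eq_Cube]; exact H.W_ne_top hr _ (by linarith)
      have hv0 : volume Q ≠ 0 := volume_Qc_ne_zero x hk
      have hvt : volume Q ≠ ⊤ := volume_Qc_ne_top x _
      have hv3 : volume Q3 = 3 ^ n * volume Q := by
        rw [hQ, hQ3, volume_Qc, volume_Qc, ← mul_pow]
        congr 1
        rw [show 2 * (3 * (2 : ℝ) ^ k) = 3 * (2 * (2 : ℝ) ^ k) by ring,
          ENNReal.ofReal_mul (by norm_num)]
        simp
      set D := ∫⁻ z in Q, f z with hD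
      have i1 : (D / ν Q3) ^ (r - 1) * volume Q ≤ MX μ h x * μ Q := by
        calc (D / ν Q3) ^ (r - 1) * volume Q = ∫⁻ y in Q, (D / ν Q3) ^ (r - 1) := by simp
          _ ≤ ∫⁻ y in Q, G y ^ (r - 1) :=
            setLIntegral_mono (hGm.pow_const _) fun y hy =>
              ENNReal.rpow_le_rpow (step1 x k y hy) hr1.le
          _ = ∫⁻ y in Q, h y ∂μ := by
            rw [hμ, setLIntegral_withDensity_eq_setLIntegral_mul _ H.meas hhm
              (measurableSet_Qc _ _)]
            refine lintegral_congr_ae (ae_restrict_of_ae ?_)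
            filter_upwards [H.pos, H.fin] with z h1 h2
            simp only [Pi.mul_apply, hh]
            rw [ENNReal.mul_div_cancel h1 h2]
          _ ≤ MX μ h x * μ Q := by
            rw [← ENNReal.div_le_iff hμ0 hμt]
            exact le_MX μ h x k
      have i2 : D ^ (r - 1) * volume Q ≤ c3 * A * MX μ h x * volume Q ^ (r - 1) * volume Q := by
        have e1 : D ^ (r - 1) = (D / ν Q3) ^ (r - 1) * ν Q3 ^ (r - 1) := by
          rw [← ENNReal.mul_rpow_of_nonneg _ _ hr1.le, ENNReal.div_mul_cancel hν0 hνt]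
        have e2 : μ Q * ν Q3 ^ (r - 1) ≤ A * volume Q3 ^ r := by
          have hsub : Q ⊆ Q3 := by
            intro z hz i
            exact (hz i).trans (by linarith)
          calc μ Q * ν Q3 ^ (r - 1) ≤ (∫⁻ y in Q3, W y) * (∫⁻ y in Q3, S y) ^ (r - 1) := by
                rw [hμQ, hν3]; gcongr
            _ ≤ A * volume Q3 ^ r := by
                rw [hQ3, Qc_eq_Cube]; exact H.bound _ _ (by linarith)
        have e3 : volume Q ^ r = volume Q ^ (r - 1) * volume Q := by
          conv_rhs => rw [← ENNReal.rpow_one (volume Q), ← ENNReal.rpow_mul]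
          rw [← ENNReal.rpow_add _ _ hv0 hvt]; congr 1; ring
        calc D ^ (r - 1) * volume Q = ((D / ν Q3) ^ (r - 1) * volume Q) * ν Q3 ^ (r - 1) := by
              rw [e1]; ring
          _ ≤ MX μ h x * μ Q * ν Q3 ^ (r - 1) := mul_le_mul_left i1 _
          _ = MX μ h x * (μ Q * ν Q3 ^ (r - 1)) := by ring
          _ ≤ MX μ h x * (A * volume Q3 ^ r) := mul_le_mul_right e2 _
          _ = _ := by
              rw [hv3, ENNReal.mul_rpow_of_nonneg _ _ (by linarith : (0:ℝ) ≤ r), e3, hc3]; ring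
      have i3 : (D / volume Q) ^ (r - 1) ≤ c3 * A * MX μ h x := by
        rw [ENNReal.div_rpow_of_nonneg _ _ hr1.le,
          ENNReal.div_le_iff (rpow_ne_zero_of hv0 hvt) (rpow_ne_top_of hv0 hvt)]
        exact (ENNReal.mul_le_mul_iff_left hv0 hvt).1 i2
      rw [le_rpow_one_div hr1]
      exact i3
    rwa [le_rpow_one_div hr1] at this
  have step3 : ∀ x, MX volume f x ^ r ≤ (c3 * A) ^ (r / (r - 1)) * MX μ h x ^ (r / (r - 1)) := by
    intro x
    have := ENNReal.rpow_le_rpow (step2 x) hr'0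
    rw [← ENNReal.rpow_mul, ENNReal.mul_rpow_of_nonneg _ _ hr'0,
      show (r - 1) * (r / (r - 1)) = r by field_simp] at this
    exact this
  have hMμ : Measurable (MX μ h) := measurable_MX μ hhm
  have hcA : (c3 * A) ^ (r / (r - 1)) = c3 ^ (r / (r - 1)) * A ^ (r / (r - 1)) :=
    ENNReal.mul_rpow_of_nonneg _ _ hr'0
  have k1 : ∫⁻ x, h x ^ (r / (r - 1)) ∂μ = ∫⁻ x, G x ^ r ∂ν := by
    rw [hμ, hν, lintegral_withDensity_eq_lintegral_mul _ H.meas (hhm.pow_const _),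
      lintegral_withDensity_eq_lintegral_mul _ hSm (hGm.pow_const _)]
    refine lintegral_congr_ae ?_
    filter_upwards [H.pos, H.fin] with x h1 h2
    simp only [Pi.mul_apply, hh, hS]
    rw [ENNReal.div_rpow_of_nonneg _ _ hr'0, ← ENNReal.rpow_mul,
      show (r - 1) * (r / (r - 1)) = r by field_simp, div_eq_mul_inv, ← ENNReal.rpow_neg,
      mul_comm (G x ^ r), ← mul_assoc]
    congr 1
    nth_rewrite 1 [← ENNReal.rpow_one (W x)]
    rw [← ENNReal.rpow_add _ _ h1 h2]
    congr 1
    field_simp; ring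
  have k2 : ∫⁻ x, (f x / S x) ^ r ∂ν = ∫⁻ x, W x * f x ^ r := by
    rw [hν, lintegral_withDensity_eq_lintegral_mul _ hSm (hfS.pow_const _)]
    refine lintegral_congr_ae ?_
    filter_upwards [H.pos, H.fin] with x h1 h2
    simp only [Pi.mul_apply, hS]
    rw [ENNReal.div_rpow_of_nonneg _ _ (by linarith), div_eq_mul_inv (f x ^ r), ← ENNReal.rpow_neg,
      mul_comm (f x ^ r), ← mul_assoc, ← ENNReal.rpow_mul, ← ENNReal.rpow_add _ _ h1 h2]
    congr 1
    have : -(1 / (r - 1)) + -(1 / (r - 1)) * -r = 1 := by field_simp; ring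
    rw [this, ENNReal.rpow_one]
  calc ∫⁻ x, W x * MX volume f x ^ r
      ≤ ∫⁻ x, (c3 * A) ^ (r / (r - 1)) * (W x * MX μ h x ^ (r / (r - 1))) := by
        refine lintegral_mono fun x => ?_
        rw [mul_left_comm]
        exact mul_le_mul_right (step3 x) _
    _ = (c3 * A) ^ (r / (r - 1)) * ∫⁻ x, MX μ h x ^ (r / (r - 1)) ∂μ := by
        have hm : Measurable fun x => W x * MX μ h x ^ (r / (r - 1)) :=
          H.meas.mul (hMμ.pow_const _)
        have e : ∫⁻ x, MX μ h x ^ (r / (r - 1)) ∂μ = ∫⁻ x, W x * MX μ h x ^ (r / (r - 1)) :=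
          lintegral_withDensity_eq_lintegral_mul _ H.meas (hMμ.pow_const _)
        rw [lintegral_const_mul _ hm, e]
    _ ≤ (c3 * A) ^ (r / (r - 1)) * (C1 * ∫⁻ x, h x ^ (r / (r - 1)) ∂μ) :=
        mul_le_mul_right (H1 μ h hhm) _
    _ ≤ (c3 * A) ^ (r / (r - 1)) * (C1 * (C2 * ∫⁻ x, W x * f x ^ r)) := by
        rw [k1, ← k2]
        exact mul_le_mul_right (mul_le_mul_right (H2 ν _ hfS) _) _
    _ = _ := by rw [hcA]; ring


/-! ### The Rubio de Francia algorithm -/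

/-- Iterates of the maximal operator. -/
def MXiter (g : Euc n → ℝ≥0∞) : ℕ → Euc n → ℝ≥0∞
  | 0 => g
  | k + 1 => MX volume (MXiter g k)

lemma measurable_MXiter {g : Euc n → ℝ≥0∞} (hg : Measurable g) (k : ℕ) :
    Measurable (MXiter g k) := by
  induction k with
  | zero => exact hg
  | succ k ih => exact measurable_MX _ ih

lemma MX_tsum_le (c : ℕ → ℝ≥0∞) (F : ℕ → Euc n → ℝ≥0∞) (hF : ∀ k, Measurable (F k)) (x : Euc n) :
    MX volume (fun y => ∑' k, c k * F k y) x ≤ ∑' k, c k * MX volume (F k) x := by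
  refine iSup_le fun j => ?_
  rw [lintegral_tsum fun k => ((hF k).const_mul (c k)).aemeasurable, div_eq_mul_inv,
    ← ENNReal.tsum_mul_right]
  refine ENNReal.tsum_le_tsum fun k => ?_
  rw [lintegral_const_mul _ (hF k), mul_assoc, ← div_eq_mul_inv]
  exact mul_le_mul_right (le_MX volume (F k) x j) _

lemma MX_pos {g : Euc n → ℝ≥0∞} (hg : Measurable g) (h0 : ¬ g =ᵐ[volume] 0) (x : Euc n) :
    MX volume g x ≠ 0 := by
  intro hx
  apply h0
  have h1 : ∀ k : ℤ, ∀ᵐ y, y ∈ Qc x ((2 : ℝ) ^ k) → g y = 0 := by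
    intro k
    have : (∫⁻ y in Qc x ((2 : ℝ) ^ k), g y) / volume (Qc x ((2 : ℝ) ^ k)) = 0 := by
      have := le_MX volume g x k
      rw [hx] at this
      exact nonpos_iff_eq_zero.1 this
    rw [ENNReal.div_eq_zero_iff] at this
    have h2 := this.resolve_right (volume_Qc_ne_top x _)
    rw [lintegral_eq_zero_iff hg] at h2
    exact (ae_restrict_iff' (measurableSet_Qc _ _)).1 h2
  filter_upwards [ae_all_iff.2 h1] with y hy
  obtain ⟨m, hm⟩ := pow_unbounded_of_one_lt ‖y - x‖ (by norm_num : (1 : ℝ) < 2)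
  refine hy m fun i => ?_
  have h2 : ‖(y - x) i‖ ≤ ‖y - x‖ := PiLp.norm_apply_le (y - x) i
  simp only [PiLp.sub_apply, Real.norm_eq_abs] at h2
  rw [zpow_natCast]
  linarith

lemma tsum_two_inv_mul_rpow_le {r : ℝ} (hr : 1 ≤ r) (b : ℕ → ℝ≥0∞) :
    (∑' k, (2⁻¹ : ℝ≥0∞) ^ k * b k) ^ r ≤ 2 ^ r * ∑' k, b k ^ r := by
  have hr0 : 0 < r := by linarith
  have h1 : ∑' k, (2⁻¹ : ℝ≥0∞) ^ k * b k ≤ 2 * (∑' k, b k ^ r) ^ (1 / r) := by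
    calc ∑' k, (2⁻¹ : ℝ≥0∞) ^ k * b k ≤ ∑' k, (2⁻¹ : ℝ≥0∞) ^ k * (∑' k, b k ^ r) ^ (1 / r) := by
          refine ENNReal.tsum_le_tsum fun k => mul_le_mul_right ?_ _
          rw [le_rpow_one_div hr0]
          exact ENNReal.le_tsum k
      _ = _ := by rw [ENNReal.tsum_mul_right, ENNReal.tsum_geometric, ENNReal.one_sub_inv_two, inv_inv]
  refine (ENNReal.rpow_le_rpow h1 hr0.le).trans ?_
  rw [ENNReal.mul_rpow_of_nonneg _ _ hr0.le, ← ENNReal.rpow_mul,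
    show 1 / r * r = 1 by field_simp, ENNReal.rpow_one]

lemma rubio_de_francia (n : ℕ) {r : ℝ} (hr : 1 < r) : ∃ C : ℝ≥0∞, C ≠ ⊤ ∧
    ∀ (W : Euc n → ℝ≥0∞) (A : ℝ≥0∞), ArW r W A → ∀ g : Euc n → ℝ≥0∞, Measurable g →
      ¬ g =ᵐ[volume] 0 →
      ∃ u : Euc n → ℝ≥0∞, Measurable u ∧ (∀ x, g x ≤ u x) ∧ (∀ x, u x ≠ 0) ∧
        (∫⁻ x, W x * u x ^ r ≤ 2 ^ (r + 1) * ∫⁻ x, W x * g x ^ r) ∧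
        ∀ (a : Euc n) (h : ℝ), 0 < h → ∀ x ∈ Cube a h,
          ∫⁻ y in Cube a h, u y ≤ C * A ^ (1 / (r - 1)) * volume (Cube a h) * u x := by
  have hr1 : 0 < r - 1 := by linarith
  have hr0 : 0 < r := by linarith
  obtain ⟨C0, hC0, hB⟩ := buckley n hr
  set C1 : ℝ≥0∞ := C0 + 1 with hC1
  have hC1t : C1 ≠ ⊤ := by finiteness
  have hC10 : C1 ≠ 0 := by simp [hC1]
  refine ⟨4 ^ (n + 1) * C1 ^ (1 / r), ?_, fun W A H g hg hg0 => ?_⟩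
  · exact ENNReal.mul_ne_top (by finiteness) (rpow_ne_top_of hC10 hC1t)
  have hA0 := H.A_ne_zero hr
  set L : ℝ≥0∞ := C1 * A ^ (r / (r - 1)) with hL
  have hL0 : L ≠ 0 := mul_ne_zero hC10 (rpow_ne_zero_of hA0 H.ne_top)
  have hLt : L ≠ ⊤ := ENNReal.mul_ne_top hC1t (rpow_ne_top_of hA0 H.ne_top)
  have hLB : ∀ f : Euc n → ℝ≥0∞, Measurable f →
      ∫⁻ x, W x * MX volume f x ^ r ≤ L * ∫⁻ x, W x * f x ^ r := by
    intro f hf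
    refine (hB W A H f hf).trans ?_
    rw [hL]
    gcongr
    rw [hC1]; exact le_self_add
  clear_value L
  set K : ℝ≥0∞ := L ^ (1 / r) with hK
  have hK0 : K ≠ 0 := rpow_ne_zero_of hL0 hLt
  have hKt : K ≠ ⊤ := rpow_ne_top_of hL0 hLt
  have hKr : K ^ r = L := by
    rw [hK, ← ENNReal.rpow_mul, show 1 / r * r = 1 by field_simp, ENNReal.rpow_one]
  have hKA : K = C1 ^ (1 / r) * A ^ (1 / (r - 1)) := by
    rw [hK, hL, ENNReal.mul_rpow_of_nonneg _ _ (by positivity), ← ENNReal.rpow_mul]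
    congr 2; field_simp
  set F : ℕ → Euc n → ℝ≥0∞ := MXiter g with hF
  have hFm : ∀ k, Measurable (F k) := measurable_MXiter hg
  have h4K0 : 4 * K ≠ 0 := mul_ne_zero (by norm_num) hK0
  have h4Kt : 4 * K ≠ ⊤ := ENNReal.mul_ne_top (by norm_num) hKt
  set u : Euc n → ℝ≥0∞ := fun x => ∑' k, ((4 * K)⁻¹) ^ k * F k x with hu
  have hum : Measurable u := Measurable.tsum fun k => (hFm k).const_mul _
  have hMu : ∀ x, MX volume u x ≤ 4 * K * u x := by
    intro x
    refine (MX_tsum_le _ F hFm x).trans ?_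
    calc ∑' k, ((4 * K)⁻¹) ^ k * MX volume (F k) x
        = 4 * K * ∑' k, ((4 * K)⁻¹) ^ (k + 1) * F (k + 1) x := by
          rw [← ENNReal.tsum_mul_left]
          refine tsum_congr fun k => ?_
          change _ = 4 * K * ((4 * K)⁻¹ ^ (k + 1) * MX volume (F k) x)
          rw [pow_succ', mul_assoc ((4 * K)⁻¹), ← mul_assoc (4 * K),
            ENNReal.mul_inv_cancel h4K0 h4Kt, one_mul]
      _ ≤ 4 * K * u x := by
          refine mul_le_mul_right ?_ _
          exact ENNReal.tsum_comp_le_tsum_of_injective (add_left_injective 1)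
            (fun k => ((4 * K)⁻¹) ^ k * F k x)
  refine ⟨u, hum, ?_, ?_, ?_, ?_⟩
  · intro x
    refine le_trans ?_ (ENNReal.le_tsum 0)
    simp [hF, MXiter]
  · intro x h0
    have h1 : (4 * K)⁻¹ ^ 1 * F 1 x ≤ u x := ENNReal.le_tsum (f := fun k => ((4 * K)⁻¹) ^ k * F k x) 1
    rw [h0, nonpos_iff_eq_zero, mul_eq_zero, pow_one, ENNReal.inv_eq_zero] at h1
    rcases h1 with h1 | h1
    · exact h4Kt h1
    · exact MX_pos hg hg0 x h1
  · have hI : ∀ k, ∫⁻ x, W x * F k x ^ r ≤ L ^ k * ∫⁻ x, W x * g x ^ r := by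
      intro k
      induction k with
      | zero => simp [hF, MXiter]
      | succ k ih =>
        refine (hLB (F k) (hFm k)).trans ?_
        rw [pow_succ', mul_assoc]
        exact mul_le_mul_right ih _
    have h2K0 : 2 * K ≠ 0 := mul_ne_zero (by norm_num) hK0
    have h2Kt : 2 * K ≠ ⊤ := ENNReal.mul_ne_top (by norm_num) hKt
    have hub : ∀ x, u x ^ r ≤ 2 ^ r * ∑' k, ((2 * K)⁻¹ ^ k * F k x) ^ r := by
      intro x
      refine le_trans (le_of_eq ?_) (tsum_two_inv_mul_rpow_le hr.le _)
      congr 1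
      refine tsum_congr fun k => ?_
      rw [← mul_assoc, ← mul_pow, ← ENNReal.mul_inv (by simp) (by simp), ← mul_assoc]
      norm_num
    have hWF : ∀ k, Measurable fun x => W x * F k x ^ r := fun k =>
      H.meas.mul ((hFm k).pow_const r)
    have hpowk : ∀ k, (((2 * K)⁻¹ ^ k) ^ r : ℝ≥0∞) = ((2 ^ r)⁻¹) ^ k * (L⁻¹) ^ k := by
      intro k
      rw [← ENNReal.rpow_natCast, ← ENNReal.rpow_mul, mul_comm (k : ℝ) r, ENNReal.rpow_mul,
        ENNReal.inv_rpow, ENNReal.mul_rpow_of_nonneg _ _ hr0.le, hKr, ENNReal.rpow_natCast,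
        ← mul_pow, ENNReal.mul_inv (Or.inr hLt) (Or.inr hL0)]
    have h2r : ((2 : ℝ≥0∞) ^ r)⁻¹ ≤ 2⁻¹ := by
      rw [ENNReal.inv_le_inv]
      nth_rewrite 1 [← ENNReal.rpow_one 2]
      exact ENNReal.rpow_le_rpow_of_exponent_le (by norm_num) hr.le
    calc ∫⁻ x, W x * u x ^ r
        ≤ ∫⁻ x, 2 ^ r * ∑' k, ((2 * K)⁻¹ ^ k) ^ r * (W x * F k x ^ r) := by
          refine lintegral_mono fun x => ?_
          refine (mul_le_mul_right (hub x) _).trans (le_of_eq ?_)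
          rw [mul_left_comm, ← ENNReal.tsum_mul_left]
          congr 1
          refine tsum_congr fun k => ?_
          rw [ENNReal.mul_rpow_of_nonneg _ _ hr0.le]; ring
      _ = 2 ^ r * ∑' k, ((2 * K)⁻¹ ^ k) ^ r * ∫⁻ x, W x * F k x ^ r := by
          rw [lintegral_const_mul _ (Measurable.tsum fun k => (hWF k).const_mul _),
            lintegral_tsum fun k => ((hWF k).const_mul _).aemeasurable]
          congr 1
          refine tsum_congr fun k => ?_
          rw [lintegral_const_mul _ (hWF k)]
      _ ≤ 2 ^ r * ∑' k, (2⁻¹ : ℝ≥0∞) ^ k * ∫⁻ x, W x * g x ^ r := by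
          refine mul_le_mul_right (ENNReal.tsum_le_tsum fun k => ?_) _
          calc _ ≤ ((2 * K)⁻¹ ^ k) ^ r * (L ^ k * ∫⁻ x, W x * g x ^ r) :=
                mul_le_mul_right (hI k) _
            _ = ((2 ^ r)⁻¹) ^ k * ((L⁻¹ * L) ^ k * ∫⁻ x, W x * g x ^ r) := by
                rw [hpowk, mul_pow]; ring
            _ ≤ _ := by
                rw [ENNReal.inv_mul_cancel hL0 hLt, one_pow, one_mul]
                gcongr
      _ = _ := by
          rw [ENNReal.tsum_mul_right, ENNReal.tsum_geometric, ENNReal.one_sub_inv_two, inv_inv,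
            ENNReal.rpow_add _ _ (by norm_num) (by norm_num), ENNReal.rpow_one, mul_assoc]
  · intro a h hh x hx
    obtain ⟨m, hm1, hm2⟩ := exists_mem_Ioc_zpow hh (by norm_num : (1 : ℝ) < 2)
    have hsub : Cube a h ⊆ Qc x ((2 : ℝ) ^ (m + 1)) := by
      intro y hy i
      have h1 := hx i
      have h2 := hy i
      rw [abs_le]
      constructor <;> linarith
    have hle : (2 : ℝ) ^ (m + 1) ≤ 2 * h := by
      rw [zpow_add₀ (by norm_num), zpow_one]; linarith
    have hvol : volume (Qc x ((2 : ℝ) ^ (m + 1))) ≤ 4 ^ n * volume (Cube a h) := by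
      rw [volume_Qc, volume_Cube, ← mul_pow]
      refine pow_le_pow_left' ?_ n
      have : (4 : ℝ≥0∞) = ENNReal.ofReal 4 := by simp
      rw [this, ← ENNReal.ofReal_mul (by norm_num)]
      exact ENNReal.ofReal_le_ofReal (by linarith)
    have hv0 := volume_Qc_ne_zero x (two_zpow_pos (m + 1))
    have hvt := volume_Qc_ne_top x ((2 : ℝ) ^ (m + 1))
    calc ∫⁻ y in Cube a h, u y ≤ ∫⁻ y in Qc x ((2 : ℝ) ^ (m + 1)), u y := lintegral_mono_set hsub
      _ ≤ MX volume u x * volume (Qc x ((2 : ℝ) ^ (m + 1))) := by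
          rw [← ENNReal.div_le_iff hv0 hvt]; exact le_MX volume u x (m + 1)
      _ ≤ (4 * K * u x) * (4 ^ n * volume (Cube a h)) := mul_le_mul' (hMu x) hvol
      _ = _ := by rw [hKA]; ring


/-! ### Passing between `A_{p,q}` and `A_r` -/

lemma div_dualExp {p q : ℝ} (hp : 1 ≤ p) : q / dualExp p = q * (1 - 1 / p) := by
  unfold dualExp
  rcases hp.eq_or_lt with rfl | hp
  · simp
  · have : p - 1 ≠ 0 := by linarith
    have : p ≠ 0 := by linarith
    field_simp

/-- Real valued weight `V^{1/q₀}`. -/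
def vOf (q₀ : ℝ) (V : Euc n → ℝ≥0∞) : Euc n → ℝ := fun x => (V x).toReal ^ (1 / q₀)

lemma ofReal_vOf {q₀ : ℝ} (hq₀ : 0 < q₀) {V : Euc n → ℝ≥0∞} {x : Euc n} (hx : V x ≠ ⊤) :
    ENNReal.ofReal (vOf q₀ V x) = V x ^ (1 / q₀) := by
  unfold vOf
  rw [← ENNReal.ofReal_rpow_of_nonneg ENNReal.toReal_nonneg (by positivity), ENNReal.ofReal_toReal hx]

lemma Apq_vOf_le {p₀ q₀ : ℝ} (hp₀ : 1 < p₀) (hq₀ : 0 < q₀) {V : Euc n → ℝ≥0∞}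
    (hV : ∀ᵐ x, V x ≠ ⊤) {s₀ : ℝ} (hs₀ : 0 < s₀) (hs : q₀ / dualExp p₀ = s₀) {B : ℝ≥0∞}
    (hB : ∀ (a : Euc n) (h : ℝ), 0 < h →
      (∫⁻ x in Cube a h, V x) * (∫⁻ x in Cube a h, V x ^ (-(1 / s₀))) ^ s₀ ≤
        B * volume (Cube a h) ^ (1 + s₀)) :
    Apq p₀ q₀ (vOf q₀ V) ≤ B := by
  unfold Apq
  refine iSup_le fun a => iSup_le fun h => iSup_le fun hh => ?_
  have hd : dualExp p₀ = q₀ / s₀ := by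
    have hd0 : dualExp p₀ ≠ 0 := by
      rintro h0; rw [h0] at hs; simp at hs; linarith
    rw [← hs]; field_simp
  rw [if_neg hp₀.ne', hs, hd]
  have e1 : ∫⁻ x in Cube a h, ENNReal.ofReal (vOf q₀ V x) ^ q₀ = ∫⁻ x in Cube a h, V x := by
    refine lintegral_congr_ae (ae_restrict_of_ae ?_)
    filter_upwards [hV] with x hx
    rw [ofReal_vOf hq₀ hx, ← ENNReal.rpow_mul, show 1 / q₀ * q₀ = 1 by field_simp, ENNReal.rpow_one]
  have e2 : ∫⁻ x in Cube a h, ENNReal.ofReal (vOf q₀ V x) ^ (-(q₀ / s₀)) =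
      ∫⁻ x in Cube a h, V x ^ (-(1 / s₀)) := by
    refine lintegral_congr_ae (ae_restrict_of_ae ?_)
    filter_upwards [hV] with x hx
    rw [ofReal_vOf hq₀ hx, ← ENNReal.rpow_mul, show 1 / q₀ * (-(q₀ / s₀)) = -(1 / s₀) by field_simp]
  rw [e1, e2]
  set v := volume (Cube a h) with hv
  have hv0 : v ≠ 0 := volume_Cube_ne_zero a hh
  have hvt : v ≠ ⊤ := volume_Cube_ne_top a h
  clear_value v
  rw [ENNReal.mul_rpow_of_nonneg _ _ hs₀.le]
  calc _ = (v⁻¹ * v⁻¹ ^ s₀) * ((∫⁻ x in Cube a h, V x) *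
        (∫⁻ x in Cube a h, V x ^ (-(1 / s₀))) ^ s₀) := by ring
    _ ≤ (v⁻¹ * v⁻¹ ^ s₀) * (B * v ^ (1 + s₀)) := mul_le_mul_right (by rw [hv]; exact hB a h hh) _
    _ = (v⁻¹ * v) * (v⁻¹ ^ s₀ * v ^ s₀) * B := by
        rw [ENNReal.rpow_add _ _ hv0 hvt, ENNReal.rpow_one]; ring
    _ = B := by
        rw [← ENNReal.mul_rpow_of_nonneg _ _ hs₀.le, ENNReal.inv_mul_cancel hv0 hvt]; simp

lemma Apq_one_vOf_le {q₀ : ℝ} (hq₀ : 0 < q₀) {V : Euc n → ℝ≥0∞}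
    (hV : ∀ᵐ x, V x ≠ ⊤) {B : ℝ≥0∞} (hB0 : B ≠ 0) (hBt : B ≠ ⊤)
    (hB : ∀ (a : Euc n) (h : ℝ), 0 < h → ∀ x ∈ Cube a h,
      (∫⁻ y in Cube a h, V y) ≤ B * volume (Cube a h) * V x) :
    Apq 1 q₀ (vOf q₀ V) ≤ B := by
  unfold Apq
  refine iSup_le fun a => iSup_le fun h => iSup_le fun hh => ?_
  rw [if_pos rfl]
  have e1 : ∫⁻ x in Cube a h, ENNReal.ofReal (vOf q₀ V x) ^ q₀ = ∫⁻ x in Cube a h, V x := by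
    refine lintegral_congr_ae (ae_restrict_of_ae ?_)
    filter_upwards [hV] with x hx
    rw [ofReal_vOf hq₀ hx, ← ENNReal.rpow_mul, show 1 / q₀ * q₀ = 1 by field_simp, ENNReal.rpow_one]
  rw [e1]
  set v := volume (Cube a h) with hv
  have hv0 : v ≠ 0 := volume_Cube_ne_zero a hh
  have hvt : v ≠ ⊤ := volume_Cube_ne_top a h
  set m := v⁻¹ * ∫⁻ x in Cube a h, V x with hm
  have h1 : essSup (fun x => (ENNReal.ofReal (vOf q₀ V x))⁻¹) (volume.restrict (Cube a h)) ≤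
      (B / m) ^ (1 / q₀) := by
    refine essSup_le_of_ae_le _ ?_
    have h2 : ∀ᵐ x ∂(volume.restrict (Cube a h)), V x ≠ ⊤ := ae_restrict_of_ae hV
    filter_upwards [h2, ae_restrict_mem (measurableSet_Cube a h)] with x hx hxQ
    rw [ofReal_vOf hq₀ hx, ← ENNReal.inv_rpow]
    refine ENNReal.rpow_le_rpow ?_ (by positivity)
    have h3 : m ≤ B * V x := by
      calc m ≤ v⁻¹ * (B * v * V x) := mul_le_mul_right (hB a h hh x hxQ) _
        _ = (v⁻¹ * v) * (B * V x) := by ring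
        _ = B * V x := by rw [ENNReal.inv_mul_cancel hv0 hvt, one_mul]
    rw [← ENNReal.inv_div (Or.inl hBt) (Or.inl hB0), ENNReal.inv_le_inv]
    exact ENNReal.div_le_of_le_mul' h3
  calc m * _ ≤ m * ((B / m) ^ (1 / q₀)) ^ q₀ :=
        mul_le_mul_right (ENNReal.rpow_le_rpow h1 hq₀.le) _
    _ = m * (B / m) := by
        rw [← ENNReal.rpow_mul, show 1 / q₀ * q₀ = 1 by field_simp, ENNReal.rpow_one]
    _ ≤ B := ENNReal.mul_div_le

lemma transfer {p₀ q₀ γ c₀ : ℝ} (hp₀ : 1 ≤ p₀) (hq₀ : 0 < q₀) (hγ : 0 < γ) {f Φ : Euc n → ℝ}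
    (hT : ∀ w : Euc n → ℝ, Measurable w → (∀ x, 0 ≤ w x) → Apq p₀ q₀ w < ⊤ →
      weakLp (fun x => w x ^ q₀) Φ q₀ ≤ ENNReal.ofReal c₀ * Apq p₀ q₀ w ^ γ * wLp w f p₀)
    {V : Euc n → ℝ≥0∞} (hVm : Measurable V) (hV : ∀ᵐ x, V x ≠ ⊤) {B : ℝ≥0∞} (hBt : B ≠ ⊤)
    (hB : Apq p₀ q₀ (vOf q₀ V) ≤ B) {t : ℝ} (ht : 0 < t) :
    ENNReal.ofReal t * (∫⁻ x in {x | t < |Φ x|}, V x) ^ (1 / q₀) ≤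
      ENNReal.ofReal c₀ * B ^ γ *
        (∫⁻ x, V x ^ (p₀ / q₀) * ENNReal.ofReal |f x| ^ p₀) ^ (1 / p₀) := by
  have hm : Measurable (vOf q₀ V) := by
    unfold vOf; exact hVm.ennreal_toReal.pow_const _
  have h0 : ∀ x, 0 ≤ vOf q₀ V x := fun x => Real.rpow_nonneg ENNReal.toReal_nonneg _
  have h1 := hT _ hm h0 (hB.trans_lt (lt_top_iff_ne_top.2 hBt))
  have h2 : ENNReal.ofReal t * wMeas (fun x => vOf q₀ V x ^ q₀) {x | t < |Φ x|} ^ (1 / q₀) ≤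
      weakLp (fun x => vOf q₀ V x ^ q₀) Φ q₀ :=
    le_iSup₂ (f := fun (t : ℝ) (_ : 0 < t) => ENNReal.ofReal t *
      wMeas (fun x => vOf q₀ V x ^ q₀) {x | t < |Φ x|} ^ (1 / q₀)) t ht
  have h3 : wMeas (fun x => vOf q₀ V x ^ q₀) {x | t < |Φ x|} = ∫⁻ x in {x | t < |Φ x|}, V x := by
    unfold wMeas
    refine lintegral_congr_ae (ae_restrict_of_ae ?_)
    filter_upwards [hV] with x hx
    rw [← ENNReal.ofReal_rpow_of_nonneg (h0 x) hq₀.le, ofReal_vOf hq₀ hx, ← ENNReal.rpow_mul,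
      show 1 / q₀ * q₀ = 1 by field_simp, ENNReal.rpow_one]
  have h4 : wLp (vOf q₀ V) f p₀ =
      (∫⁻ x, V x ^ (p₀ / q₀) * ENNReal.ofReal |f x| ^ p₀) ^ (1 / p₀) := by
    unfold wLp
    congr 1
    refine lintegral_congr_ae ?_
    filter_upwards [hV] with x hx
    rw [ofReal_vOf hq₀ hx, ENNReal.mul_rpow_of_nonneg _ _ (by linarith), ← ENNReal.rpow_mul,
      show 1 / q₀ * p₀ = p₀ / q₀ by field_simp]
  rw [h3] at h2
  rw [← h4]
  refine h2.trans (h1.trans ?_)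
  gcongr

lemma arW_of_Apq {p q s : ℝ} (hp : 1 < p) (hq : 0 < q) (hs0 : 0 < s) (hs : q / dualExp p = s)
    {w : Euc n → ℝ} (hw : Measurable w) (hA : Apq p q w < ⊤) :
    (∀ᵐ x, ENNReal.ofReal (w x) ^ q = 0) ∨
      ArW (1 + s) (fun x => ENNReal.ofReal (w x) ^ q) (Apq p q w) := by
  have hd : dualExp p = q / s := by
    have hd0 : dualExp p ≠ 0 := by
      rintro h0; rw [h0] at hs; simp at hs; linarith
    rw [← hs]; field_simp
  have hWm : Measurable fun x => ENNReal.ofReal (w x) ^ q := hw.ennreal_ofReal.pow_const _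
  have hWt : ∀ x, ENNReal.ofReal (w x) ^ q ≠ ⊤ := fun x =>
    ENNReal.rpow_ne_top_of_nonneg hq.le ENNReal.ofReal_ne_top
  have hsig : ∀ x, (ENNReal.ofReal (w x) ^ q) ^ (-(1 / s)) =
      ENNReal.ofReal (w x) ^ (-(dualExp p)) := by
    intro x
    rw [← ENNReal.rpow_mul, hd]; congr 1; ring
  have hbound : ∀ (a : Euc n) (h : ℝ), 0 < h →
      (∫⁻ x in Cube a h, ENNReal.ofReal (w x) ^ q) *
        (∫⁻ x in Cube a h, (ENNReal.ofReal (w x) ^ q) ^ (-(1 / s))) ^ s ≤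
      Apq p q w * volume (Cube a h) ^ (1 + s) := by
    intro a h hh
    have h1 : ((volume (Cube a h))⁻¹ * ∫⁻ x in Cube a h, ENNReal.ofReal (w x) ^ q) *
        ((volume (Cube a h))⁻¹ * ∫⁻ x in Cube a h,
            ENNReal.ofReal (w x) ^ (-(dualExp p))) ^ s ≤ Apq p q w := by
      unfold Apq
      refine le_trans ?_ (le_iSup _ a)
      refine le_trans ?_ (le_iSup _ h)
      refine le_trans ?_ (le_iSup _ hh)
      rw [if_neg hp.ne', hs]
    simp_rw [hsig]
    set v := volume (Cube a h) with hv
    have hv0 : v ≠ 0 := volume_Cube_ne_zero a hh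
    have hvt : v ≠ ⊤ := volume_Cube_ne_top a h
    clear_value v
    set I := ∫⁻ x in Cube a h, ENNReal.ofReal (w x) ^ q
    set J := ∫⁻ x in Cube a h, ENNReal.ofReal (w x) ^ (-(dualExp p))
    calc I * J ^ s = (v⁻¹ * v) * (v⁻¹ ^ s * v ^ s) * (I * J ^ s) := by
          rw [← ENNReal.mul_rpow_of_nonneg _ _ hs0.le, ENNReal.inv_mul_cancel hv0 hvt]; simp
      _ = ((v⁻¹ * I) * (v⁻¹ * J) ^ s) * v ^ (1 + s) := by
          rw [ENNReal.mul_rpow_of_nonneg _ _ hs0.le, ENNReal.rpow_add _ _ hv0 hvt,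
            ENNReal.rpow_one]; ring
      _ ≤ _ := mul_le_mul_left h1 _
  by_cases hpos : ∀ᵐ x, ENNReal.ofReal (w x) ^ q ≠ 0
  · right
    refine ⟨hWm, hpos, Filter.Eventually.of_forall hWt, ?_, hA.ne⟩
    rw [show 1 + s - 1 = s by ring]
    exact hbound
  · left
    -- some big cube meets the zero set in positive measure
    set Z : Set (Euc n) := {x | ENNReal.ofReal (w x) ^ q = 0} with hZ
    have hZm : MeasurableSet Z := hWm (measurableSet_singleton 0)
    have hZ0 : volume Z ≠ 0 := by
      rw [ae_iff] at hpos
      simpa [hZ] using hpos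
    have hmono : Monotone fun j : ℕ => Qc (0 : Euc n) ((j : ℝ) + 1) := by
      intro i j hij x hx k
      have : (i : ℝ) ≤ j := by exact_mod_cast hij
      exact (hx k).trans (by linarith)
    have hex : ∃ j0 : ℕ, volume (Z ∩ Qc (0 : Euc n) ((j0 : ℝ) + 1)) ≠ 0 := by
      by_contra hcon
      push Not at hcon
      apply hZ0
      have : Z = ⋃ j : ℕ, Z ∩ Qc (0 : Euc n) ((j : ℝ) + 1) := by
        rw [← inter_iUnion, iUnion_Qc, inter_univ]
      rw [this]
      exact measure_iUnion_null hcon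
    obtain ⟨j0, hj0⟩ := hex
    have hzero : ∀ j : ℕ, j0 ≤ j → ∀ᵐ x, x ∈ Qc (0 : Euc n) ((j : ℝ) + 1) →
        ENNReal.ofReal (w x) ^ q = 0 := by
      intro j hj
      set Q := Qc (0 : Euc n) ((j : ℝ) + 1) with hQ
      have hvQ : volume (Z ∩ Q) ≠ 0 := by
        intro h0
        exact hj0 (measure_mono_null (inter_subset_inter_right _ (hmono hj)) h0)
      have hb := hbound (WithLp.toLp 2 (fun i => (0 : Euc n) i - ((j : ℝ) + 1)))
        (2 * ((j : ℝ) + 1)) (by positivity)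
      rw [← Qc_eq_Cube] at hb
      have hJ : ∫⁻ x in Q, (ENNReal.ofReal (w x) ^ q) ^ (-(1 / s)) = ⊤ := by
        rw [eq_top_iff]
        calc ⊤ = ∫⁻ x in Z ∩ Q, ⊤ := by
              rw [setLIntegral_const, ENNReal.top_mul hvQ]
          _ = ∫⁻ x in Z ∩ Q, (ENNReal.ofReal (w x) ^ q) ^ (-(1 / s)) := by
              refine setLIntegral_congr_fun (hZm.inter (measurableSet_Qc _ _)) fun x hx => ?_
              have : ENNReal.ofReal (w x) ^ q = 0 := hx.1
              rw [this, ENNReal.zero_rpow_of_neg]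
              have : 0 < 1 / s := by positivity
              linarith
          _ ≤ _ := lintegral_mono_set inter_subset_right
      rw [hJ, ENNReal.top_rpow_of_pos hs0] at hb
      have hI : ∫⁻ x in Q, ENNReal.ofReal (w x) ^ q = 0 := by
        by_contra hne
        rw [ENNReal.mul_top hne, top_le_iff] at hb
        exact ENNReal.mul_ne_top hA.ne (ENNReal.rpow_ne_top_of_nonneg (by linarith)
          (volume_Qc_ne_top _ _)) hb
      rw [lintegral_eq_zero_iff hWm] at hI
      exact (ae_restrict_iff' (measurableSet_Qc _ _)).1 hI
    have hall : ∀ᵐ x, ∀ j : ℕ, j0 ≤ j → x ∈ Qc (0 : Euc n) ((j : ℝ) + 1) →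
        ENNReal.ofReal (w x) ^ q = 0 := by
      rw [ae_all_iff]; intro j
      by_cases hj : j0 ≤ j
      · filter_upwards [hzero j hj] with x hx _ using hx
      · exact Filter.Eventually.of_forall fun x h => absurd h hj
    filter_upwards [hall] with x hx
    have : x ∈ ⋃ j : ℕ, Qc (0 : Euc n) ((j : ℝ) + 1) := by rw [iUnion_Qc]; trivial
    obtain ⟨j, hj⟩ := mem_iUnion.1 this
    exact hx (max j0 j) (le_max_left _ _) (hmono (le_max_right j0 j) hj)



/-! ### The two families of auxiliary weights -/

lemma a1_mean {u : Euc n → ℝ≥0∞} {D : ℝ≥0∞} (hum : Measurable u) (hu0 : ∀ x, u x ≠ 0)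
    (huT : ∀ᵐ x, u x ≠ ⊤) (hDt : D ≠ ⊤)
    (hD : ∀ (a : Euc n) (h : ℝ), 0 < h → ∀ x ∈ Cube a h,
      ∫⁻ y in Cube a h, u y ≤ D * volume (Cube a h) * u x) (a : Euc n) {h : ℝ} (hh : 0 < h) :
    ∃ m : ℝ≥0∞, m ≠ 0 ∧ m ≠ ⊤ ∧ (∫⁻ y in Cube a h, u y) = m * (D * volume (Cube a h)) ∧
      ∀ x ∈ Cube a h, m ≤ u x := by
  have hI0 : ∫⁻ y in Cube a h, u y ≠ 0 :=
    setLIntegral_Cube_ne_zero hum (Filter.Eventually.of_forall hu0) a hh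
  have hv0 := volume_Cube_ne_zero a hh
  have hvt := volume_Cube_ne_top a h
  have hex : ∃ x ∈ Cube a h, u x ≠ ⊤ := by
    by_contra hcon
    push Not at hcon
    apply hv0
    refine measure_mono_null (fun x hx => ?_) (ae_iff.1 huT)
    simpa using hcon x hx
  obtain ⟨x, hx, hxt⟩ := hex
  have hIt : ∫⁻ y in Cube a h, u y ≠ ⊤ :=
    ne_top_of_le_ne_top (ENNReal.mul_ne_top (ENNReal.mul_ne_top hDt hvt) hxt) (hD a h hh x hx)
  have hD0 : D ≠ 0 := by
    rintro rfl
    exact hI0 (by simpa using hD a h hh x hx)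
  have hDv0 : D * volume (Cube a h) ≠ 0 := mul_ne_zero hD0 hv0
  have hDvt : D * volume (Cube a h) ≠ ⊤ := ENNReal.mul_ne_top hDt hvt
  refine ⟨(∫⁻ y in Cube a h, u y) / (D * volume (Cube a h)), ?_, ?_, ?_, ?_⟩
  · exact (ENNReal.div_pos hI0 hDvt).ne'
  · exact ENNReal.div_ne_top hIt hDv0
  · rw [ENNReal.div_mul_cancel hDv0 hDvt]
  · intro y hy
    exact ENNReal.div_le_of_le_mul' (hD a h hh y hy)

lemma rpow_neg_le_of_le {m x : ℝ≥0∞} {e : ℝ} (he : 0 ≤ e) (h : m ≤ x) :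
    x ^ (-e) ≤ m ^ (-e) := by
  rw [ENNReal.rpow_neg, ENNReal.rpow_neg, ENNReal.inv_le_inv]
  exact ENNReal.rpow_le_rpow h he

lemma rpow_neg_mul_self {m : ℝ≥0∞} (h0 : m ≠ 0) (ht : m ≠ ⊤) (e : ℝ) : m ^ (-e) * m ^ e = 1 := by
  rw [← ENNReal.rpow_add _ _ h0 ht]; simp

lemma weight_a {s s₀ : ℝ} (hs : 0 < s) (hss : s < s₀) {W u : Euc n → ℝ≥0∞} {A D : ℝ≥0∞}
    (H : ArW (1 + s) W A) (hum : Measurable u) (hu0 : ∀ x, u x ≠ 0)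
    (huT : ∀ᵐ x, u x ≠ ⊤) (hDt : D ≠ ⊤)
    (hD : ∀ (a : Euc n) (h : ℝ), 0 < h → ∀ x ∈ Cube a h,
      ∫⁻ y in Cube a h, u y ≤ D * volume (Cube a h) * u x) (a : Euc n) (h : ℝ) (hh : 0 < h) :
    (∫⁻ x in Cube a h, W x * u x ^ (-(s₀ - s))) *
      (∫⁻ x in Cube a h, (W x * u x ^ (-(s₀ - s))) ^ (-(1 / s₀))) ^ s₀ ≤
      (A * D ^ (s₀ - s)) * volume (Cube a h) ^ (1 + s₀) := by
  obtain ⟨m, hm0, hmt, hmI, hmu⟩ := a1_mean hum hu0 huT hDt hD a hh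
  have hs₀ : 0 < s₀ := hs.trans hss
  have he : 0 ≤ s₀ - s := by linarith
  have hb := H.bound a h hh
  rw [show 1 + s - 1 = s by ring] at hb
  have h1 : (∫⁻ x in Cube a h, W x * u x ^ (-(s₀ - s))) ≤
      m ^ (-(s₀ - s)) * ∫⁻ x in Cube a h, W x := by
    rw [← lintegral_const_mul _ H.meas]
    refine setLIntegral_mono' (measurableSet_Cube a h) fun x hx => ?_
    rw [mul_comm]
    exact mul_le_mul_left (rpow_neg_le_of_le he (hmu x hx)) _
  have h2 : (∫⁻ x in Cube a h, (W x * u x ^ (-(s₀ - s))) ^ (-(1 / s₀))) ≤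
      (∫⁻ x in Cube a h, W x ^ (-(1 / s))) ^ (s / s₀) *
        (∫⁻ x in Cube a h, u x) ^ ((s₀ - s) / s₀) := by
    refine le_trans (le_of_eq ?_) (ENNReal.lintegral_mul_norm_pow_le
      (μ := volume.restrict (Cube a h)) (f := fun x => W x ^ (-(1 / s))) (g := u)
      (H.meas.pow_const _).aemeasurable hum.aemeasurable (by positivity) (by positivity)
      (by field_simp; ring))
    refine lintegral_congr_ae (ae_restrict_of_ae ?_)
    filter_upwards [huT, H.pos, H.fin] with x hxt hW0 hWt
    have := hu0 x
    rw [ENNReal.mul_rpow_of_ne_zero hW0 (rpow_ne_zero_of this hxt), ← ENNReal.rpow_mul,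
      ← ENNReal.rpow_mul]
    congr 2 <;> field_simp
  rw [hmI] at h2
  have hb' := hb
  set v := volume (Cube a h) with hv
  have hv0 : v ≠ 0 := volume_Cube_ne_zero a hh
  have hvt : v ≠ ⊤ := volume_Cube_ne_top a h
  clear_value v
  set I := ∫⁻ x in Cube a h, W x
  set S := ∫⁻ x in Cube a h, W x ^ (-(1 / s))
  calc _ ≤ (m ^ (-(s₀ - s)) * I) * (S ^ (s / s₀) * (m * (D * v)) ^ ((s₀ - s) / s₀)) ^ s₀ :=
        mul_le_mul' h1 (ENNReal.rpow_le_rpow h2 hs₀.le)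
    _ = (m ^ (-(s₀ - s)) * m ^ (s₀ - s)) * (I * S ^ s) * D ^ (s₀ - s) * v ^ (s₀ - s) := by
        rw [ENNReal.mul_rpow_of_nonneg _ _ hs₀.le, ← ENNReal.rpow_mul, ← ENNReal.rpow_mul,
          show s / s₀ * s₀ = s by field_simp, show (s₀ - s) / s₀ * s₀ = s₀ - s by field_simp,
          ENNReal.mul_rpow_of_nonneg _ _ he, ENNReal.mul_rpow_of_nonneg _ _ he]
        ring
    _ ≤ 1 * (A * v ^ (1 + s)) * D ^ (s₀ - s) * v ^ (s₀ - s) := by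
        rw [rpow_neg_mul_self hm0 hmt]
        gcongr
    _ = _ := by
        rw [show 1 + s₀ = (1 + s) + (s₀ - s) by ring, ENNReal.rpow_add (1 + s) _ hv0 hvt]
        ring

lemma weight_b {s s₀ : ℝ} (hs₀ : 0 < s₀) (hss : s₀ < s) {W u : Euc n → ℝ≥0∞} {A D : ℝ≥0∞}
    (H : ArW (1 + s) W A) (hum : Measurable u) (hu0 : ∀ x, u x ≠ 0)
    (huT : ∀ᵐ x, u x ≠ ⊤) (hDt : D ≠ ⊤)
    (hD : ∀ (a : Euc n) (h : ℝ), 0 < h → ∀ x ∈ Cube a h,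
      ∫⁻ y in Cube a h, u y ≤ D * volume (Cube a h) * u x) (a : Euc n) (h : ℝ) (hh : 0 < h) :
    (∫⁻ x in Cube a h, W x ^ (s₀ / s) * u x ^ (1 - s₀ / s)) *
      (∫⁻ x in Cube a h, (W x ^ (s₀ / s) * u x ^ (1 - s₀ / s)) ^ (-(1 / s₀))) ^ s₀ ≤
      (A ^ (s₀ / s) * D ^ (1 - s₀ / s)) * volume (Cube a h) ^ (1 + s₀) := by
  obtain ⟨m, hm0, hmt, hmI, hmu⟩ := a1_mean hum hu0 huT hDt hD a hh
  have hs : 0 < s := hs₀.trans hss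
  have he : 0 ≤ 1 - s₀ / s := by
    rw [sub_nonneg, div_le_one hs]; exact hss.le
  have hb := H.bound a h hh
  rw [show 1 + s - 1 = s by ring] at hb
  have h1 : (∫⁻ x in Cube a h, W x ^ (s₀ / s) * u x ^ (1 - s₀ / s)) ≤
      (∫⁻ x in Cube a h, W x) ^ (s₀ / s) * (∫⁻ x in Cube a h, u x) ^ (1 - s₀ / s) :=
    ENNReal.lintegral_mul_norm_pow_le
      (μ := volume.restrict (Cube a h)) (f := W) (g := u)
      H.meas.aemeasurable hum.aemeasurable (by positivity) he (by ring)
  have h2 : (∫⁻ x in Cube a h, (W x ^ (s₀ / s) * u x ^ (1 - s₀ / s)) ^ (-(1 / s₀))) ≤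
      m ^ (-((1 - s₀ / s) / s₀)) * ∫⁻ x in Cube a h, W x ^ (-(1 / s)) := by
    rw [← lintegral_const_mul _ (H.meas.pow_const _)]
    refine lintegral_mono_ae ?_
    have g1 : ∀ᵐ x ∂(volume.restrict (Cube a h)), u x ≠ ⊤ := ae_restrict_of_ae huT
    have g2 : ∀ᵐ x ∂(volume.restrict (Cube a h)), W x ≠ 0 := ae_restrict_of_ae H.pos
    have g3 : ∀ᵐ x ∂(volume.restrict (Cube a h)), W x ≠ ⊤ := ae_restrict_of_ae H.fin
    filter_upwards [g1, g2, g3, ae_restrict_mem (measurableSet_Cube a h)] with x hxt hW0 hWt hx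
    have := hu0 x
    rw [ENNReal.mul_rpow_of_ne_zero (rpow_ne_zero_of hW0 hWt) (rpow_ne_zero_of this hxt),
      ← ENNReal.rpow_mul, ← ENNReal.rpow_mul, mul_comm,
      show s₀ / s * -(1 / s₀) = -(1 / s) by field_simp,
      show (1 - s₀ / s) * -(1 / s₀) = -((1 - s₀ / s) / s₀) by ring]
    exact mul_le_mul_left (rpow_neg_le_of_le (by positivity) (hmu x hx)) _
  rw [hmI] at h1
  set v := volume (Cube a h) with hv
  have hv0 : v ≠ 0 := volume_Cube_ne_zero a hh
  have hvt : v ≠ ⊤ := volume_Cube_ne_top a h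
  clear_value v
  set I := ∫⁻ x in Cube a h, W x
  set S := ∫⁻ x in Cube a h, W x ^ (-(1 / s))
  set e := 1 - s₀ / s with hee
  calc _ ≤ (I ^ (s₀ / s) * (m * (D * v)) ^ e) * (m ^ (-(e / s₀)) * S) ^ s₀ :=
        mul_le_mul' h1 (ENNReal.rpow_le_rpow h2 hs₀.le)
    _ = (m ^ (-e) * m ^ e) * (I * S ^ s) ^ (s₀ / s) * D ^ e * v ^ e := by
        rw [ENNReal.mul_rpow_of_nonneg _ _ hs₀.le, ← ENNReal.rpow_mul,
          ENNReal.mul_rpow_of_nonneg I _ (show 0 ≤ s₀ / s by positivity), ← ENNReal.rpow_mul,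
          show s * (s₀ / s) = s₀ by field_simp, show -(e / s₀) * s₀ = -e by field_simp,
          ENNReal.mul_rpow_of_nonneg _ _ he, ENNReal.mul_rpow_of_nonneg _ _ he]
        ring
    _ ≤ 1 * (A * v ^ (1 + s)) ^ (s₀ / s) * D ^ e * v ^ e := by
        rw [rpow_neg_mul_self hm0 hmt]
        gcongr
    _ = _ := by
        rw [ENNReal.mul_rpow_of_nonneg _ _ (show 0 ≤ s₀ / s by positivity), ← ENNReal.rpow_mul,
          show 1 + s₀ = (1 + s) * (s₀ / s) + e by rw [hee]; field_simp; ring,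
          ENNReal.rpow_add _ e hv0 hvt]
        ring


/-! ### The case `q < q₀` -/

lemma ae_ne_top_of_lintegral {W u : Euc n → ℝ≥0∞} {r : ℝ} (hr : 0 < r) (hWm : Measurable W)
    (hum : Measurable u) (hW : ∀ᵐ x, W x ≠ 0) (h : ∫⁻ x, W x * u x ^ r ≠ ⊤) :
    ∀ᵐ x, u x ≠ ⊤ := by
  have := ae_lt_top (hWm.mul (hum.pow_const r)) h
  filter_upwards [this, hW] with x hx hx0 hxt
  have hx : W x * u x ^ r < ⊤ := hx
  rw [hxt, ENNReal.top_rpow_of_pos hr, ENNReal.mul_top hx0] at hx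
  exact lt_irrefl _ hx

lemma case_a (n : ℕ) {p₀ q₀ p q γ c₀ s s₀ : ℝ} (hp : 1 < p) (hq : 0 < q) (hp₀ : 1 < p₀)
    (hq₀ : 0 < q₀) (hs : s = q * (1 - 1 / p)) (hs₀ : s₀ = q₀ * (1 - 1 / p₀))
    (hexp : 1 / p - 1 / q = 1 / p₀ - 1 / q₀) (hqq : q < q₀) (hγ : 0 < γ) :
    ∃ K : ℝ≥0∞, K ≠ ⊤ ∧ ∀ (W : Euc n → ℝ≥0∞) (A : ℝ≥0∞) (f Φ : Euc n → ℝ), Measurable f →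
      ArW (1 + s) W A →
      (∀ w : Euc n → ℝ, Measurable w → (∀ x, 0 ≤ w x) → Apq p₀ q₀ w < ⊤ →
        weakLp (fun x => w x ^ q₀) Φ q₀ ≤ ENNReal.ofReal c₀ * Apq p₀ q₀ w ^ γ * wLp w f p₀) →
      ∀ t : ℝ, 0 < t → ENNReal.ofReal t * (∫⁻ x in {x | t < |Φ x|}, W x) ^ (1 / q) ≤
        K * A ^ (γ * (s₀ / s)) *
          (∫⁻ x, W x ^ (p / q) * ENNReal.ofReal |f x| ^ p) ^ (1 / p) := by
  have hp0 : 0 < p := by linarith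
  have hp₀0 : 0 < p₀ := by linarith
  have hs0 : 0 < s := by
    rw [hs]; have : 1 / p < 1 := by rw [div_lt_one hp0]; exact hp
    exact mul_pos hq (by linarith)
  have hs₀0 : 0 < s₀ := by
    rw [hs₀]; have : 1 / p₀ < 1 := by rw [div_lt_one hp₀0]; exact hp₀
    exact mul_pos hq₀ (by linarith)
  -- normalised exponents
  set κ : ℝ := 1 - (1 / p - 1 / q) with hκ
  have hr1 : 1 + s = κ * q := by rw [hs, hκ]; field_simp; ring
  have hr2 : 1 + s₀ = κ * q₀ := by rw [hs₀, hκ, hexp]; field_simp; ring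
  have hκ0 : 0 < κ := by
    by_contra hcon
    have : κ * q ≤ 0 := mul_nonpos_of_nonpos_of_nonneg (not_lt.1 hcon) hq.le
    linarith
  have hss : s < s₀ := by
    have : κ * q < κ * q₀ := mul_lt_mul_of_pos_left hqq hκ0
    linarith
  have hδ : 1 / p - 1 / p₀ = 1 / q - 1 / q₀ := by linarith
  have hδ0 : 0 < 1 / q - 1 / q₀ := by
    have := one_div_lt_one_div_of_lt hq hqq
    linarith
  obtain ⟨C, hCt, hRdF⟩ := rubio_de_francia n (show 1 < 1 + s by linarith)
  refine ⟨ENNReal.ofReal c₀ * C ^ ((s₀ - s) * γ) * ((2 : ℝ≥0∞) ^ (1 + s + 1)) ^ (1 / q - 1 / q₀) + 1,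
    ?_, ?_⟩
  · refine ENNReal.add_ne_top.2 ⟨ENNReal.mul_ne_top (ENNReal.mul_ne_top ENNReal.ofReal_ne_top
      (ENNReal.rpow_ne_top_of_nonneg (mul_nonneg (by linarith) hγ.le) hCt)) ?_, ENNReal.one_ne_top⟩
    exact ENNReal.rpow_ne_top_of_nonneg hδ0.le
      (ENNReal.rpow_ne_top_of_nonneg (by linarith) (by norm_num))
  intro W A f Φ hf H hT t ht
  have hA0 : A ≠ 0 := H.A_ne_zero (by linarith)
  have hAt : A ≠ ⊤ := H.ne_top
  have hfm : Measurable fun x => ENNReal.ofReal |f x| := by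
    exact (measurable_norm.comp hf).ennreal_ofReal
  have hFm : Measurable fun x => W x ^ (p / q) * ENNReal.ofReal |f x| ^ p :=
    (H.meas.pow_const _).mul (hfm.pow_const _)
  set F := ∫⁻ x, W x ^ (p / q) * ENNReal.ofReal |f x| ^ p with hF
  have hAexp0 : A ^ (γ * (s₀ / s)) ≠ 0 := rpow_ne_zero_of hA0 hAt
  by_cases hFt : F = ⊤
  · rw [hFt, ENNReal.top_rpow_of_pos (by positivity), ENNReal.mul_top]
    · exact le_top
    · exact mul_ne_zero (by simp) hAexp0
  by_cases hF0 : F = 0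
  · have hf0 : ∀ᵐ x, ENNReal.ofReal |f x| = 0 := by
      rw [hF, lintegral_eq_zero_iff hFm] at hF0
      filter_upwards [hF0, H.pos, H.fin] with x hx h0 h1
      have hx' : W x ^ (p / q) * ENNReal.ofReal |f x| ^ p = 0 := hx
      rcases mul_eq_zero.1 hx' with h | h
      · exact absurd h (rpow_ne_zero_of h0 h1)
      · exact (ENNReal.rpow_eq_zero_iff_of_pos hp0).1 h
    have h1 := transfer (n := n) (V := fun _ => 1) (B := 1) hp₀.le hq₀ hγ hT measurable_const
      (Filter.Eventually.of_forall fun _ => ENNReal.one_ne_top) ENNReal.one_ne_top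
      (Apq_vOf_le hp₀ hq₀ (Filter.Eventually.of_forall fun _ => ENNReal.one_ne_top) hs₀0
        (by rw [div_dualExp hp₀.le, hs₀]) (by
          intro a h hh
          simp only [ENNReal.one_rpow, lintegral_const, one_mul, Measure.restrict_apply_univ]
          rw [ENNReal.rpow_add _ _ (volume_Cube_ne_zero a hh) (volume_Cube_ne_top a h),
            ENNReal.rpow_one])) ht
    have h2 : ∫⁻ x : Euc n, (1 : ℝ≥0∞) ^ (p₀ / q₀) * ENNReal.ofReal |f x| ^ p₀ = 0 := by
      refine (lintegral_eq_zero_iff (measurable_const.mul (hfm.pow_const _))).2 ?_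
      filter_upwards [hf0] with x hx
      simp [hx, hp₀0]
    rw [h2, ENNReal.zero_rpow_of_pos (by positivity), mul_zero, nonpos_iff_eq_zero] at h1
    rcases mul_eq_zero.1 h1 with h | h
    · exact absurd h (by simpa using ht)
    · rw [ENNReal.rpow_eq_zero_iff_of_pos (by positivity), setLIntegral_const, one_mul] at h
      rw [setLIntegral_measure_zero _ _ h, ENNReal.zero_rpow_of_pos (by positivity), mul_zero]
      exact zero_le
  -- main case
  set g : Euc n → ℝ≥0∞ := fun x => (ENNReal.ofReal |f x| ^ p * W x ^ (p / q - 1)) ^ (1 / (1 + s))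
    with hg
  have hgm : Measurable g := ((hfm.pow_const _).mul (H.meas.pow_const _)).pow_const _
  have hr0 : 0 < 1 + s := by linarith
  have hgF : ∫⁻ x, W x * g x ^ (1 + s) = F := by
    refine lintegral_congr_ae ?_
    filter_upwards [H.pos, H.fin] with x h0 h1
    simp only [hg]
    rw [← ENNReal.rpow_mul, show 1 / (1 + s) * (1 + s) = 1 by field_simp, ENNReal.rpow_one]
    calc W x * (ENNReal.ofReal |f x| ^ p * W x ^ (p / q - 1))
        = (W x ^ (1 : ℝ) * W x ^ (p / q - 1)) * ENNReal.ofReal |f x| ^ p := by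
          rw [ENNReal.rpow_one]; ring
      _ = _ := by
          rw [← ENNReal.rpow_add _ _ h0 h1]; congr 2; ring
  have hgne : ¬ g =ᵐ[volume] 0 := by
    intro h
    apply hF0
    rw [← hgF]
    refine (lintegral_eq_zero_iff (H.meas.mul (hgm.pow_const _))).2 ?_
    filter_upwards [h] with x hx
    simp [hx, hr0]
  obtain ⟨u, hum, hgu, hu0, huW, huA⟩ := hRdF W A H g hgm hgne
  rw [hgF] at huW
  have h2t : (2 : ℝ≥0∞) ^ (1 + s + 1) ≠ ⊤ := ENNReal.rpow_ne_top_of_nonneg (by linarith) (by norm_num)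
  have huT : ∀ᵐ x, u x ≠ ⊤ :=
    ae_ne_top_of_lintegral hr0 H.meas hum H.pos
      (ne_top_of_le_ne_top (ENNReal.mul_ne_top h2t hFt) huW)
  rw [show 1 + s - 1 = s by ring] at huA
  have hDt : C * A ^ (1 / s) ≠ ⊤ :=
    ENNReal.mul_ne_top hCt (ENNReal.rpow_ne_top_of_nonneg (by positivity) hAt)
  have he : 0 ≤ s₀ - s := by linarith
  set V : Euc n → ℝ≥0∞ := fun x => W x * u x ^ (-(s₀ - s)) with hV
  have hVm : Measurable V := H.meas.mul (hum.pow_const _)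
  have hVt : ∀ᵐ x, V x ≠ ⊤ := by
    filter_upwards [huT, H.fin] with x h1 h2
    exact ENNReal.mul_ne_top h2 (rpow_ne_top_of (hu0 x) h1)
  have hBt : A * (C * A ^ (1 / s)) ^ (s₀ - s) ≠ ⊤ :=
    ENNReal.mul_ne_top hAt (ENNReal.rpow_ne_top_of_nonneg he hDt)
  have hmain := transfer hp₀.le hq₀ hγ hT hVm hVt hBt
    (Apq_vOf_le hp₀ hq₀ hVt hs₀0 (by rw [div_dualExp hp₀.le, hs₀])
      (weight_a hs0 hss H hum hu0 huT hDt huA)) ht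
  -- the right-hand side
  have hR : ∫⁻ x, V x ^ (p₀ / q₀) * ENNReal.ofReal |f x| ^ p₀ ≤ F := by
    refine lintegral_mono_ae ?_
    filter_upwards [huT, H.pos, H.fin] with x hut h0 h1
    set φ := ENNReal.ofReal |f x| with hφ
    by_cases hφ0 : φ = 0
    · rw [hφ0, ENNReal.zero_rpow_of_pos hp₀0, mul_zero]; exact zero_le
    have hφt : φ ≠ ⊤ := ENNReal.ofReal_ne_top
    have hgx : (φ ^ p * W x ^ (p / q - 1)) ^ (1 / (1 + s)) ≤ u x := hgu x
    clear_value φ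
    have e1 : (s₀ - s) * (p₀ / q₀) = (1 + s) * (p₀ / p - 1) := by
      have : s₀ - s = κ * (q₀ - q) := by linarith
      rw [this, hr1]
      have h5 : p₀ / p - 1 = p₀ * (1 / p - 1 / p₀) := by field_simp
      rw [h5, hδ]; field_simp
    have e2 : p₀ / q₀ - (p / q - 1) * (p₀ / p - 1) = p / q := by
      have h5 : p₀ / q₀ = 1 - p₀ * (1 / p - 1 / q) := by rw [hexp]; field_simp; ring
      rw [h5]; field_simp; ring
    have e3 : 0 ≤ p₀ / p - 1 := by
      have h5 : p₀ / p - 1 = p₀ * (1 / p - 1 / p₀) := by field_simp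
      rw [h5, hδ]; positivity
    have hφp0 : φ ^ p ≠ 0 := rpow_ne_zero_of hφ0 hφt
    have hWq0 : W x ^ (p / q - 1) ≠ 0 := rpow_ne_zero_of h0 h1
    have hux := hu0 x
    calc V x ^ (p₀ / q₀) * φ ^ p₀
        = W x ^ (p₀ / q₀) * u x ^ (-((1 + s) * (p₀ / p - 1))) * φ ^ p₀ := by
          simp only [hV]
          rw [ENNReal.mul_rpow_of_ne_zero h0 (rpow_ne_zero_of hux hut), ← ENNReal.rpow_mul,
            ← e1, neg_mul]
      _ ≤ W x ^ (p₀ / q₀) * ((φ ^ p * W x ^ (p / q - 1)) ^ (1 / (1 + s))) ^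
            (-((1 + s) * (p₀ / p - 1))) * φ ^ p₀ := by
          refine mul_le_mul_left (mul_le_mul_right ?_ _) _
          exact rpow_neg_le_of_le (mul_nonneg hr0.le e3) hgx
      _ = (W x ^ (p₀ / q₀) * W x ^ (-((p / q - 1) * (p₀ / p - 1)))) *
            (φ ^ (-(p₀ - p)) * φ ^ p₀) := by
          rw [← ENNReal.rpow_mul, show 1 / (1 + s) * -((1 + s) * (p₀ / p - 1)) = -(p₀ / p - 1) by
            field_simp, ENNReal.mul_rpow_of_ne_zero hφp0 hWq0, ← ENNReal.rpow_mul,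
            ← ENNReal.rpow_mul, show p * -(p₀ / p - 1) = -(p₀ - p) by field_simp, mul_neg]
          ring
      _ = W x ^ (p / q) * φ ^ p := by
          rw [← ENNReal.rpow_add _ _ h0 h1, ← ENNReal.rpow_add _ _ hφ0 hφt, ← sub_eq_add_neg, e2,
            show -(p₀ - p) + p₀ = p by ring]
  -- Hölder on the left
  have hqq1 : 0 ≤ 1 - q / q₀ := by rw [sub_nonneg, div_le_one hq₀]; exact hqq.le
  have hL : ∫⁻ x in {x | t < |Φ x|}, W x ≤ (∫⁻ x in {x | t < |Φ x|}, V x) ^ (q / q₀) *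
      ((2 : ℝ≥0∞) ^ (1 + s + 1) * F) ^ (1 - q / q₀) := by
    calc ∫⁻ x in {x | t < |Φ x|}, W x
        = ∫⁻ x in {x | t < |Φ x|}, V x ^ (q / q₀) * (W x * u x ^ (1 + s)) ^ (1 - q / q₀) := by
          refine lintegral_congr_ae (ae_restrict_of_ae ?_)
          filter_upwards [huT, H.pos, H.fin] with x hut h0 h1
          have hux := hu0 x
          simp only [hV]
          rw [ENNReal.mul_rpow_of_ne_zero h0 (rpow_ne_zero_of hux hut),
            ENNReal.mul_rpow_of_ne_zero h0 (rpow_ne_zero_of hux hut),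
            ← ENNReal.rpow_mul, ← ENNReal.rpow_mul]
          have e4 : -(s₀ - s) * (q / q₀) + (1 + s) * (1 - q / q₀) = 0 := by
            have : s₀ - s = κ * (q₀ - q) := by linarith
            rw [this, hr1]; field_simp; ring
          calc W x = W x ^ (q / q₀ + (1 - q / q₀)) *
                u x ^ (-(s₀ - s) * (q / q₀) + (1 + s) * (1 - q / q₀)) := by
                rw [e4]; simp
            _ = _ := by
                rw [ENNReal.rpow_add _ _ h0 h1, ENNReal.rpow_add _ _ hux hut]; ring
      _ ≤ (∫⁻ x in {x | t < |Φ x|}, V x) ^ (q / q₀) *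
          (∫⁻ x in {x | t < |Φ x|}, W x * u x ^ (1 + s)) ^ (1 - q / q₀) :=
          ENNReal.lintegral_mul_norm_pow_le hVm.aemeasurable
            (H.meas.mul (hum.pow_const _)).aemeasurable (by positivity) hqq1 (by ring)
      _ ≤ _ := by
          gcongr
          exact (setLIntegral_le_lintegral _ _).trans huW
  set X := ∫⁻ x in {x | t < |Φ x|}, V x with hX
  clear_value X
  have hq1 : 0 ≤ 1 / q := by positivity
  have hγ0 := hγ.le
  calc ENNReal.ofReal t * (∫⁻ x in {x | t < |Φ x|}, W x) ^ (1 / q)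
      ≤ ENNReal.ofReal t * (X ^ (q / q₀) *
          ((2 : ℝ≥0∞) ^ (1 + s + 1) * F) ^ (1 - q / q₀)) ^ (1 / q) := by gcongr
    _ = (ENNReal.ofReal t * X ^ (1 / q₀)) *
          ((2 : ℝ≥0∞) ^ (1 + s + 1) * F) ^ (1 / q - 1 / q₀) := by
        rw [ENNReal.mul_rpow_of_nonneg _ _ hq1, ← ENNReal.rpow_mul, ← ENNReal.rpow_mul,
          show q / q₀ * (1 / q) = 1 / q₀ by field_simp,
          show (1 - q / q₀) * (1 / q) = 1 / q - 1 / q₀ by field_simp]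
        ring
    _ ≤ (ENNReal.ofReal c₀ * (A * (C * A ^ (1 / s)) ^ (s₀ - s)) ^ γ * F ^ (1 / p₀)) *
          ((2 : ℝ≥0∞) ^ (1 + s + 1) * F) ^ (1 / q - 1 / q₀) := by
        refine mul_le_mul_left (hmain.trans ?_) _
        gcongr
    _ = (ENNReal.ofReal c₀ * C ^ ((s₀ - s) * γ) * ((2 : ℝ≥0∞) ^ (1 + s + 1)) ^ (1 / q - 1 / q₀)) *
          A ^ (γ * (s₀ / s)) * F ^ (1 / p) := by
        have a1 : A * (C * A ^ (1 / s)) ^ (s₀ - s) = C ^ (s₀ - s) * A ^ (s₀ / s) := by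
          rw [ENNReal.mul_rpow_of_nonneg _ _ he, ← ENNReal.rpow_mul]
          calc _ = C ^ (s₀ - s) * (A ^ (1 : ℝ) * A ^ (1 / s * (s₀ - s))) := by
                rw [ENNReal.rpow_one]; ring
            _ = _ := by
                rw [← ENNReal.rpow_add _ _ hA0 hAt]; congr 2; field_simp; ring
        rw [a1, ENNReal.mul_rpow_of_nonneg _ _ hγ0, ENNReal.mul_rpow_of_nonneg _ F hδ0.le,
          ← ENNReal.rpow_mul C, ← ENNReal.rpow_mul A,
          show F ^ (1 / p) = F ^ (1 / p₀) * F ^ (1 / q - 1 / q₀) by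
            rw [← ENNReal.rpow_add _ _ hF0 hFt]; congr 1; linarith, mul_comm γ]
        ring
    _ ≤ _ := by
        gcongr
        exact le_self_add


/-! ### The case `q₀ < q` -/

lemma case_b (n : ℕ) {p₀ q₀ p q γ c₀ s s₀ : ℝ} (hp : 1 < p) (hq : 0 < q) (hp₀ : 1 ≤ p₀)
    (hq₀ : 0 < q₀) (hs : s = q * (1 - 1 / p)) (hs₀ : s₀ = q₀ * (1 - 1 / p₀))
    (hexp : 1 / p - 1 / q = 1 / p₀ - 1 / q₀) (hqq : q₀ < q) (hγ : 0 < γ) :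
    ∃ K : ℝ≥0∞, K ≠ ⊤ ∧ ∀ (W : Euc n → ℝ≥0∞) (A : ℝ≥0∞) (f Φ : Euc n → ℝ), Measurable f →
      ArW (1 + s) W A →
      (∀ w : Euc n → ℝ, Measurable w → (∀ x, 0 ≤ w x) → Apq p₀ q₀ w < ⊤ →
        weakLp (fun x => w x ^ q₀) Φ q₀ ≤ ENNReal.ofReal c₀ * Apq p₀ q₀ w ^ γ * wLp w f p₀) →
      ∀ t : ℝ, 0 < t → ENNReal.ofReal t * (∫⁻ x in {x | t < |Φ x|}, W x) ^ (1 / q) ≤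
        K * A ^ γ *
          (∫⁻ x, W x ^ (p / q) * ENNReal.ofReal |f x| ^ p) ^ (1 / p) := by
  have hp0 : 0 < p := by linarith
  have hp₀0 : 0 < p₀ := by linarith
  have hs0 : 0 < s := by
    rw [hs]; have : 1 / p < 1 := by rw [div_lt_one hp0]; exact hp
    exact mul_pos hq (by linarith)
  have hs₀0 : 0 ≤ s₀ := by
    rw [hs₀]; have : 1 / p₀ ≤ 1 := by rw [div_le_one hp₀0]; exact hp₀
    exact mul_nonneg hq₀.le (by linarith)
  set κ : ℝ := 1 - (1 / p - 1 / q) with hκ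
  have hr1 : 1 + s = κ * q := by rw [hs, hκ]; field_simp; ring
  have hr2 : 1 + s₀ = κ * q₀ := by rw [hs₀, hκ, hexp]; field_simp; ring
  have hκ0 : 0 < κ := by
    by_contra hcon
    have : κ * q ≤ 0 := mul_nonpos_of_nonpos_of_nonneg (not_lt.1 hcon) hq.le
    linarith
  have hss : s₀ < s := by
    have : κ * q₀ < κ * q := mul_lt_mul_of_pos_left hqq hκ0
    linarith
  have hδ : 1 / p₀ - 1 / p = 1 / q₀ - 1 / q := by linarith
  have hδ0 : 0 < 1 / q₀ - 1 / q := by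
    have := one_div_lt_one_div_of_lt hq₀ hqq
    linarith
  have hθ : 0 ≤ 1 - s₀ / s := by
    rw [sub_nonneg, div_le_one hs0]; exact hss.le
  set r' : ℝ := (1 + s) / s with hr'
  have hr'1 : r' - 1 = 1 / s := by rw [hr']; field_simp; ring
  have hr'g : 1 < r' := by
    have : 0 < 1 / s := by positivity
    linarith
  obtain ⟨C, hCt, hRdF⟩ := rubio_de_francia n hr'g
  have h2t : (2 : ℝ≥0∞) ^ (r' + 1) ≠ ⊤ := ENNReal.rpow_ne_top_of_nonneg (by linarith) (by norm_num)
  refine ⟨ENNReal.ofReal c₀ * C ^ ((1 - s₀ / s) * γ) * ((2 : ℝ≥0∞) ^ (r' + 1)) ^ (1 / q₀ - 1 / q),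
    ?_, ?_⟩
  · refine ENNReal.mul_ne_top (ENNReal.mul_ne_top ENNReal.ofReal_ne_top
      (ENNReal.rpow_ne_top_of_nonneg (mul_nonneg hθ hγ.le) hCt)) ?_
    exact ENNReal.rpow_ne_top_of_nonneg hδ0.le h2t
  intro W A f Φ hf H hT t ht
  have hA0 : A ≠ 0 := H.A_ne_zero (by linarith)
  have hAt : A ≠ ⊤ := H.ne_top
  have hfm : Measurable fun x => ENNReal.ofReal |f x| := by
    exact (measurable_norm.comp hf).ennreal_ofReal
  have hFm : Measurable fun x => W x ^ (p / q) * ENNReal.ofReal |f x| ^ p :=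
    (H.meas.pow_const _).mul (hfm.pow_const _)
  have H2 : ArW r' (fun x => W x ^ (-(1 / s))) (A ^ (1 / s)) := by
    have := H.dual (by linarith)
    simpa only [add_sub_cancel_left] using this
  set F := ∫⁻ x, W x ^ (p / q) * ENNReal.ofReal |f x| ^ p with hF
  set E : Set (Euc n) := {x | t < |Φ x|} with hE
  set E1 := toMeasurable volume E with hE1
  have hE1m : MeasurableSet E1 := measurableSet_toMeasurable _ _
  have hres : volume.restrict E1 = volume.restrict E := Measure.restrict_toMeasurable_of_sFinite E
  set R := ENNReal.ofReal c₀ * C ^ ((1 - s₀ / s) * γ) *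
    ((2 : ℝ≥0∞) ^ (r' + 1)) ^ (1 / q₀ - 1 / q) * A ^ γ * F ^ (1 / p) with hR
  clear_value E
  have hγ0 := hγ.le
  have hto : ENNReal.ofReal t ≠ 0 := by simpa using ht
  have htt : ENNReal.ofReal t ≠ ⊤ := ENNReal.ofReal_ne_top
  have key : ∀ j : ℕ, ENNReal.ofReal t *
      (∫⁻ x in E1 ∩ Qc 0 ((j : ℝ) + 1), W x) ^ (1 / q) ≤ R := by
    intro j
    set Ej := E1 ∩ Qc 0 ((j : ℝ) + 1) with hEj
    have hEjm : MeasurableSet Ej := hE1m.inter (measurableSet_Qc _ _)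
    set Y := ∫⁻ x in Ej, W x with hY
    by_cases hY0 : Y = 0
    · rw [hY0, ENNReal.zero_rpow_of_pos (by positivity), mul_zero]; exact zero_le
    have hYt : Y ≠ ⊤ := by
      refine ne_top_of_le_ne_top ?_ (lintegral_mono_set (inter_subset_right))
      rw [Qc_eq_Cube]
      exact H.W_ne_top (by linarith) _ (by positivity)
    set g : Euc n → ℝ≥0∞ := Ej.indicator W with hg
    have hgm : Measurable g := H.meas.indicator hEjm
    have hr'0 : 0 < r' := by linarith
    have hgY : ∫⁻ x, W x ^ (-(1 / s)) * g x ^ r' = Y := by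
      rw [hY, ← lintegral_indicator hEjm]
      refine lintegral_congr_ae ?_
      filter_upwards [H.pos, H.fin] with x h0 h1
      by_cases hx : x ∈ Ej
      · simp only [hg, indicator_of_mem hx]
        rw [← ENNReal.rpow_add _ _ h0 h1, show -(1 / s) + r' = 1 by linarith, ENNReal.rpow_one]
      · simp only [hg, indicator_of_notMem hx]
        rw [ENNReal.zero_rpow_of_pos hr'0, mul_zero]
    have hgne : ¬ g =ᵐ[volume] 0 := by
      intro h
      apply hY0
      rw [hY, ← lintegral_indicator hEjm]
      exact (lintegral_eq_zero_iff hgm).2 h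
    obtain ⟨u, hum, hgu, hu0, huW, huA⟩ := hRdF _ _ H2 g hgm hgne
    rw [hgY] at huW
    have huT : ∀ᵐ x, u x ≠ ⊤ :=
      ae_ne_top_of_lintegral hr'0 H2.meas hum H2.pos
        (ne_top_of_le_ne_top (ENNReal.mul_ne_top h2t hYt) huW)
    rw [hr'1, ← ENNReal.rpow_mul, show 1 / s * (1 / (1 / s)) = 1 by field_simp,
      ENNReal.rpow_one] at huA
    have hDt : C * A ≠ ⊤ := ENNReal.mul_ne_top hCt hAt
    set V : Euc n → ℝ≥0∞ := fun x => W x ^ (s₀ / s) * u x ^ (1 - s₀ / s) with hV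
    have hVm : Measurable V := (H.meas.pow_const _).mul (hum.pow_const _)
    have hVt : ∀ᵐ x, V x ≠ ⊤ := by
      filter_upwards [huT, H.fin] with x h1 h2
      exact ENNReal.mul_ne_top (ENNReal.rpow_ne_top_of_nonneg (by positivity) h2)
        (rpow_ne_top_of (hu0 x) h1)
    have hBt : A ^ (s₀ / s) * (C * A) ^ (1 - s₀ / s) ≠ ⊤ :=
      ENNReal.mul_ne_top (ENNReal.rpow_ne_top_of_nonneg (by positivity) hAt)
        (ENNReal.rpow_ne_top_of_nonneg hθ hDt)
    have hApq : Apq p₀ q₀ (vOf q₀ V) ≤ A ^ (s₀ / s) * (C * A) ^ (1 - s₀ / s) := by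
      rcases hp₀.eq_or_lt with h1 | h1
      · have hz : s₀ = 0 := by rw [hs₀, ← h1]; simp
        have hVu : V = u := by
          funext x; simp [hV, hz]
        rw [hVu] at hVt ⊢
        rw [← h1, hz]
        simp only [zero_div, ENNReal.rpow_zero, one_mul, sub_zero, ENNReal.rpow_one]
        refine Apq_one_vOf_le hq₀ hVt ?_ hDt huA
        intro hz2
        have h5 := huA 0 1 one_pos 0 (fun i => by simp)
        rw [hz2, zero_mul, zero_mul, nonpos_iff_eq_zero] at h5
        exact setLIntegral_Cube_ne_zero hum (Filter.Eventually.of_forall hu0) 0 one_pos h5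
      · have hs₀p : 0 < s₀ := by
          rw [hs₀]; have : 1 / p₀ < 1 := by rw [div_lt_one hp₀0]; exact h1
          exact mul_pos hq₀ (by linarith)
        exact Apq_vOf_le h1 hq₀ hVt hs₀p (by rw [div_dualExp hp₀, hs₀])
          (weight_b hs₀p hss H hum hu0 huT hDt huA)
    have hmain := transfer hp₀ hq₀ hγ hT hVm hVt hBt hApq ht
    rw [← hE] at hmain
    -- left-hand side
    have hL : Y ≤ ∫⁻ x in E, V x := by
      rw [← hres]
      calc Y ≤ ∫⁻ x in Ej, V x := by
            refine setLIntegral_mono' hEjm fun x hx => ?_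
            have h5 : W x ≤ u x := by
              have := hgu x
              rwa [hg, indicator_of_mem hx] at this
            calc W x = W x ^ (s₀ / s) * W x ^ (1 - s₀ / s) := by
                  rw [← ENNReal.rpow_add_of_nonneg _ _ (by positivity) hθ]; simp
              _ ≤ V x := by
                  simp only [hV]
                  gcongr
        _ ≤ _ := lintegral_mono_set inter_subset_left
    -- right-hand side
    have hpp : 0 ≤ 1 - p₀ / p := by
      have h5 : 1 - p₀ / p = p₀ * (1 / p₀ - 1 / p) := by field_simp
      rw [h5, hδ]; positivity
    have hRt : ∫⁻ x, V x ^ (p₀ / q₀) * ENNReal.ofReal |f x| ^ p₀ ≤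
        F ^ (p₀ / p) * ((2 : ℝ≥0∞) ^ (r' + 1) * Y) ^ (1 - p₀ / p) := by
      calc ∫⁻ x, V x ^ (p₀ / q₀) * ENNReal.ofReal |f x| ^ p₀
          = ∫⁻ x, (W x ^ (p / q) * ENNReal.ofReal |f x| ^ p) ^ (p₀ / p) *
              (W x ^ (-(1 / s)) * u x ^ r') ^ (1 - p₀ / p) := by
            refine lintegral_congr_ae ?_
            filter_upwards [huT, H.pos, H.fin] with x hut h0 h1
            have hux := hu0 x
            have hpp0 : 0 ≤ p₀ / p := by positivity
            have e1 : (1 - s₀ / s) * (p₀ / q₀) = r' * (1 - p₀ / p) := by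
              have h5 : 1 - p₀ / p = p₀ * (1 / p₀ - 1 / p) := by field_simp
              have h6 : 1 - s₀ / s = κ * (q - q₀) / s := by
                rw [show κ * (q - q₀) = s - s₀ by linarith]; field_simp
              rw [h5, hδ, h6, hr', hr1]; field_simp
            have e2 : s₀ / s * (p₀ / q₀) = p / q * (p₀ / p) + -(1 / s) * (1 - p₀ / p) := by
              have h5 : s₀ * (p₀ / q₀) = p₀ - 1 := by rw [hs₀]; field_simp
              have h6 : s / q = 1 - 1 / p := by rw [hs]; field_simp
              have h7 : s * (s₀ / s * (p₀ / q₀)) =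
                  s * (p / q * (p₀ / p) + -(1 / s) * (1 - p₀ / p)) := by
                calc s * (s₀ / s * (p₀ / q₀)) = s₀ * (p₀ / q₀) := by field_simp
                  _ = p₀ - 1 := h5
                  _ = p₀ * (1 - 1 / p) - (1 - p₀ / p) := by ring
                  _ = p₀ * (s / q) - (1 - p₀ / p) := by rw [h6]
                  _ = _ := by field_simp; ring
              exact mul_left_cancel₀ hs0.ne' h7
            simp only [hV]
            rw [ENNReal.mul_rpow_of_ne_zero (rpow_ne_zero_of h0 h1) (rpow_ne_zero_of hux hut),
              ENNReal.mul_rpow_of_ne_zero (rpow_ne_zero_of h0 h1) (rpow_ne_zero_of hux hut),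
              ENNReal.mul_rpow_of_nonneg _ _ hpp0]
            simp only [← ENNReal.rpow_mul]
            rw [e1, e2, ENNReal.rpow_add _ _ h0 h1, show p * (p₀ / p) = p₀ by field_simp]
            ring
        _ ≤ F ^ (p₀ / p) * (∫⁻ x, W x ^ (-(1 / s)) * u x ^ r') ^ (1 - p₀ / p) :=
            ENNReal.lintegral_mul_norm_pow_le hFm.aemeasurable
              ((H.meas.pow_const _).mul (hum.pow_const _)).aemeasurable (by positivity) hpp (by ring)
        _ ≤ _ := by gcongr
    have hq₀1 : 0 ≤ 1 / q₀ := by positivity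
    have hp₀1 : 0 ≤ 1 / p₀ := by positivity
    have hfin : (ENNReal.ofReal t * Y ^ (1 / q)) * Y ^ (1 / q₀ - 1 / q) ≤
        R * Y ^ (1 / q₀ - 1 / q) := by
      calc (ENNReal.ofReal t * Y ^ (1 / q)) * Y ^ (1 / q₀ - 1 / q)
          = ENNReal.ofReal t * Y ^ (1 / q₀) := by
            rw [mul_assoc, ← ENNReal.rpow_add _ _ hY0 hYt]; congr 2; ring
        _ ≤ ENNReal.ofReal t * (∫⁻ x in E, V x) ^ (1 / q₀) := by gcongr
        _ ≤ ENNReal.ofReal c₀ * (A ^ (s₀ / s) * (C * A) ^ (1 - s₀ / s)) ^ γ *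
            (F ^ (p₀ / p) * ((2 : ℝ≥0∞) ^ (r' + 1) * Y) ^ (1 - p₀ / p)) ^ (1 / p₀) := by
            refine hmain.trans ?_
            gcongr
        _ = R * Y ^ (1 / q₀ - 1 / q) := by
            have a1 : A ^ (s₀ / s) * (C * A) ^ (1 - s₀ / s) = C ^ (1 - s₀ / s) * A := by
              rw [ENNReal.mul_rpow_of_nonneg _ _ hθ]
              calc _ = C ^ (1 - s₀ / s) * (A ^ (s₀ / s) * A ^ (1 - s₀ / s)) := by ring
                _ = _ := by
                    rw [← ENNReal.rpow_add _ _ hA0 hAt]; simp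
            rw [a1, hR, ENNReal.mul_rpow_of_nonneg _ _ hγ0, ENNReal.mul_rpow_of_nonneg _ _ hp₀1]
            simp only [← ENNReal.rpow_mul]
            rw [show p₀ / p * (1 / p₀) = 1 / p by field_simp,
              show (1 - p₀ / p) * (1 / p₀) = 1 / q₀ - 1 / q by rw [← hδ]; field_simp,
              ENNReal.mul_rpow_of_nonneg _ Y hδ0.le]
            simp only [← ENNReal.rpow_mul]
            ring
    exact (ENNReal.mul_le_mul_iff_left (rpow_ne_zero_of hY0 hYt) (rpow_ne_top_of hY0 hYt)).1 hfin
  -- exhaust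
  have hmono : Monotone fun j : ℕ => E1 ∩ Qc (0 : Euc n) ((j : ℝ) + 1) := by
    intro i j hij x hx
    refine ⟨hx.1, fun k => ?_⟩
    have : (i : ℝ) ≤ j := by exact_mod_cast hij
    exact (hx.2 k).trans (by linarith)
  have hun : ∫⁻ x in E, W x = ⨆ j : ℕ, ∫⁻ x in E1 ∩ Qc 0 ((j : ℝ) + 1), W x := by
    rw [← hres, ← setLIntegral_iUnion_of_directed W hmono.directed_le, ← inter_iUnion, iUnion_Qc,
      inter_univ]
  have hb : ∫⁻ x in E, W x ≤ (R / ENNReal.ofReal t) ^ q := by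
    rw [hun]
    refine iSup_le fun j => ?_
    have h5 : (∫⁻ x in E1 ∩ Qc 0 ((j : ℝ) + 1), W x) ^ (1 / q) ≤ R / ENNReal.ofReal t := by
      rw [ENNReal.le_div_iff_mul_le (Or.inl hto) (Or.inl htt), mul_comm]
      exact key j
    calc _ = ((∫⁻ x in E1 ∩ Qc 0 ((j : ℝ) + 1), W x) ^ (1 / q)) ^ q := by
          rw [← ENNReal.rpow_mul, show 1 / q * q = 1 by field_simp, ENNReal.rpow_one]
      _ ≤ _ := ENNReal.rpow_le_rpow h5 hq.le
  calc ENNReal.ofReal t * (∫⁻ x in E, W x) ^ (1 / q)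
      ≤ ENNReal.ofReal t * ((R / ENNReal.ofReal t) ^ q) ^ (1 / q) := by
        have : 0 ≤ 1 / q := by positivity
        gcongr
    _ = ENNReal.ofReal t * (R / ENNReal.ofReal t) := by
        rw [← ENNReal.rpow_mul, show q * (1 / q) = 1 by field_simp, ENNReal.rpow_one]
    _ ≤ R := ENNReal.mul_div_le


/-- Weak-type off-diagonal extrapolation (Corollary 2.2). -/
theorem extrapolation_offdiagonal_weak
    (n : ℕ) (hn : 0 < n) (p₀ q₀ γ c₀ : ℝ)
    (hp₀ : 1 ≤ p₀) (hp₀q₀ : p₀ ≤ q₀) (hγ : 0 < γ)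
    (T : (Euc n → ℝ) → (Euc n → ℝ))
    (hT : ∀ w f : Euc n → ℝ, Measurable w → (∀ x, 0 ≤ w x) → Measurable f →
      Apq p₀ q₀ w < ⊤ →
      weakLp (fun x => w x ^ q₀) (T f) q₀ ≤
        ENNReal.ofReal c₀ * Apq p₀ q₀ w ^ γ * wLp w f p₀)
    (p q : ℝ) (hp : 1 < p) (hpq : p ≤ q)
    (hexp : 1 / p - 1 / q = 1 / p₀ - 1 / q₀) :
    ∃ c : ℝ, 0 < c ∧ ∀ w f : Euc n → ℝ, Measurable w → (∀ x, 0 ≤ w x) → Measurable f →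
      Apq p q w < ⊤ →
      weakLp (fun x => w x ^ q) (T f) q ≤
        ENNReal.ofReal c * Apq p q w ^ (γ * max 1 (q₀ / dualExp p₀ * (dualExp p / q))) *
          wLp w f p := by
  have hp0 : 0 < p := by linarith
  have hq0 : 0 < q := by linarith
  have hp₀0 : 0 < p₀ := by linarith
  have hq₀0 : 0 < q₀ := by linarith
  set s : ℝ := q * (1 - 1 / p) with hs
  set s₀ : ℝ := q₀ * (1 - 1 / p₀) with hs₀
  have hs0 : 0 < s := by
    have : 1 / p < 1 := by rw [div_lt_one hp0]; exact hp
    exact mul_pos hq0 (by linarith)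
  have hs₀0 : 0 ≤ s₀ := by
    have : 1 / p₀ ≤ 1 := by rw [div_le_one hp₀0]; exact hp₀
    exact mul_nonneg hq₀0.le (by linarith)
  have hds : q / dualExp p = s := div_dualExp hp.le
  have hexpo : q₀ / dualExp p₀ * (dualExp p / q) = s₀ / s := by
    rw [div_dualExp hp₀, ← hs₀, ← inv_div q, hds, div_eq_mul_inv]
  rw [hexpo]
  -- the level set estimate suffices
  have red : (∃ K : ℝ≥0∞, K ≠ ⊤ ∧ ∀ (W : Euc n → ℝ≥0∞) (A : ℝ≥0∞) (f Φ : Euc n → ℝ), Measurable f →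
      ArW (1 + s) W A →
      (∀ w : Euc n → ℝ, Measurable w → (∀ x, 0 ≤ w x) → Apq p₀ q₀ w < ⊤ →
        weakLp (fun x => w x ^ q₀) Φ q₀ ≤ ENNReal.ofReal c₀ * Apq p₀ q₀ w ^ γ * wLp w f p₀) →
      ∀ t : ℝ, 0 < t → ENNReal.ofReal t * (∫⁻ x in {x | t < |Φ x|}, W x) ^ (1 / q) ≤
        K * A ^ (γ * max 1 (s₀ / s)) *
          (∫⁻ x, W x ^ (p / q) * ENNReal.ofReal |f x| ^ p) ^ (1 / p)) →
      ∃ c : ℝ, 0 < c ∧ ∀ w f : Euc n → ℝ, Measurable w → (∀ x, 0 ≤ w x) → Measurable f →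
        Apq p q w < ⊤ →
        weakLp (fun x => w x ^ q) (T f) q ≤
          ENNReal.ofReal c * Apq p q w ^ (γ * max 1 (s₀ / s)) * wLp w f p := by
    rintro ⟨K, hKt, hK⟩
    refine ⟨K.toReal + 1, by positivity, ?_⟩
    intro w f hw hw0 hf hA
    unfold weakLp
    refine iSup₂_le fun t ht => ?_
    have hwm : wMeas (fun x => w x ^ q) {x | t < |T f x|} =
        ∫⁻ x in {x | t < |T f x|}, ENNReal.ofReal (w x) ^ q := by
      unfold wMeas
      refine lintegral_congr fun x => ?_
      rw [ENNReal.ofReal_rpow_of_nonneg (hw0 x) hq0.le]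
    rw [hwm]
    rcases arW_of_Apq hp hq0 hs0 hds hw hA with hz | H
    · have : ∫⁻ x in {x | t < |T f x|}, ENNReal.ofReal (w x) ^ q = 0 := by
        refine (lintegral_eq_zero_iff (hw.ennreal_ofReal.pow_const _)).2 ?_
        exact ae_restrict_of_ae hz
      rw [this, ENNReal.zero_rpow_of_pos (by positivity), mul_zero]
      exact zero_le
    · have h1 := hK _ _ f (T f) hf H (fun v hv hv0 hvA => hT v f hv hv0 hf hvA) t ht
      have h2 : wLp w f p = (∫⁻ x, (ENNReal.ofReal (w x) ^ q) ^ (p / q) *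
          ENNReal.ofReal |f x| ^ p) ^ (1 / p) := by
        unfold wLp
        congr 1
        refine lintegral_congr fun x => ?_
        rw [ENNReal.mul_rpow_of_nonneg _ _ hp0.le, ← ENNReal.rpow_mul,
          show q * (p / q) = p by field_simp]
      rw [h2]
      refine h1.trans ?_
      have h3 : K ≤ ENNReal.ofReal (K.toReal + 1) := by
        calc K = ENNReal.ofReal K.toReal := (ENNReal.ofReal_toReal hKt).symm
          _ ≤ _ := ENNReal.ofReal_le_ofReal (by linarith)
      gcongr
  have hr : s * q₀ - s₀ * q = q - q₀ := by
    have h1 : 1 + s = (1 - (1 / p - 1 / q)) * q := by rw [hs]; field_simp; ring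
    have h2 : 1 + s₀ = (1 - (1 / p - 1 / q)) * q₀ := by rw [hs₀, hexp]; field_simp; ring
    have h3 : (1 + s) * q₀ = (1 + s₀) * q := by rw [h1, h2]; ring
    linarith
  rcases lt_trichotomy q q₀ with hqq | hqq | hqq
  · apply red
    have hp₀1 : 1 < p₀ := by
      have h1 := one_div_lt_one_div_of_lt hq0 hqq
      have h2 : 1 / p₀ < 1 / p := by linarith
      exact hp.trans ((one_div_lt_one_div hp₀0 hp0).1 h2)
    have hss : 1 ≤ s₀ / s := by
      rw [le_div_iff₀ hs0, one_mul]
      by_contra hcon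
      push Not at hcon
      have h1 : s₀ * q ≤ s₀ * q₀ := mul_le_mul_of_nonneg_left hqq.le hs₀0
      have h2 : s₀ * q₀ ≤ s * q₀ := mul_le_mul_of_nonneg_right hcon.le hq₀0.le
      linarith
    rw [max_eq_right hss]
    exact case_a n hp hq0 hp₀1 hq₀0 hs hs₀ hexp hqq hγ
  · have hpp : p = p₀ := by
      rw [hqq] at hexp
      have h2 : 1 / p = 1 / p₀ := by linarith
      rw [one_div, one_div] at h2
      exact inv_injective h2
    have hss : s₀ = s := by rw [hs, hs₀, hqq, hpp]
    refine ⟨|c₀| + 1, by positivity, ?_⟩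
    intro w f hw hw0 hf hA
    rw [hss, div_self hs0.ne', max_self, mul_one, hqq, hpp]
    rw [hqq, hpp] at hA
    refine (hT w f hw hw0 hf hA).trans ?_
    have h3 : ENNReal.ofReal c₀ ≤ ENNReal.ofReal (|c₀| + 1) :=
      ENNReal.ofReal_le_ofReal (by linarith [le_abs_self c₀])
    gcongr
  · apply red
    have hss : s₀ / s ≤ 1 := by
      rw [div_le_one hs0]
      by_contra hcon
      push Not at hcon
      have h1 : s₀ * q₀ ≤ s₀ * q := mul_le_mul_of_nonneg_left hqq.le hs₀0
      have h2 : s * q₀ ≤ s₀ * q₀ := mul_le_mul_of_nonneg_right hcon.le hq₀0.le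
      linarith
    rw [max_eq_left hss, mul_one]
    exact case_b n hp hq0 hp₀ hq₀0 hs hs₀ hexp hqq hγ

end
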